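/- Let B₀^{H,K} be a bifractional Brownian motion in ℝ with indices H ∈ (0,1) and K ∈ (0,1], and let α ∈ (0, HK). For y : [0,1] → ℝ define the α-Hölder norm ‖y‖_α = sup_{s,t ∈ [0,1], s ≠ t} |y(s) − y(t)| / |s−t|^α. Then there exist positive constants c₁₃ and c₁₄ such that for all ε ∈ (0,1): exp(−c₁₃ ε^{−1/(HK−α)}) ≤ P{ ‖B₀^{H,K}‖_α ≤ ε } ≤ exp(−c₁₄ ε^{−1/(HK−α)}), where the Hölder norm is taken of the restriction of B₀^{H,K} to [0,1]. -/

import Mathlib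

open MeasureTheory ProbabilityTheory

/-- The bifractional covariance function. -/
noncomputable def Rbif (H K s t : ℝ) : ℝ :=
  (2 : ℝ) ^ (-K) * ((t ^ (2 * H) + s ^ (2 * H)) ^ K - |t - s| ^ (2 * H * K))

/-- `B` is a bifractional Brownian motion in `ℝ` with indices `H, K` on `(Ω, μ)`. -/
def IsBifBM {Ω : Type*} [MeasurableSpace Ω] (μ : Measure Ω) (H K : ℝ)
    (B : ℝ → Ω → ℝ) : Prop :=
  (∀ᵐ ω ∂μ, ContinuousOn (fun t => B t ω) (Set.Ici 0)) ∧
  ∀ (n : ℕ) (t : Fin n → ℝ), (∀ i, 0 ≤ t i) → ∀ a : Fin n → ℝ,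
    Measure.map (fun ω => ∑ i, a i * B (t i) ω) μ =
      gaussianReal 0 (Real.toNNReal (∑ i, ∑ j, a i * a j * Rbif H K (t i) (t j)))

/-- The `α`-Hölder norm of a function on `[0,1]`:
`‖y‖_α = sup_{s,t ∈ [0,1], s ≠ t} |y(s) - y(t)|/|s - t|^α`. -/
noncomputable def holderNorm (α : ℝ) (y : ℝ → ℝ) : ℝ :=
  sSup {z : ℝ | ∃ s ∈ Set.Icc (0:ℝ) 1, ∃ t ∈ Set.Icc (0:ℝ) 1,
    s ≠ t ∧ z = |y s - y t| / |s - t| ^ α}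

section Part1
open scoped ENNReal NNReal Pointwise

/-- One-dimensional Brunn–Minkowski. -/
lemma bm_one (A B C : Set ℝ) (hA : MeasurableSet A) (hB : MeasurableSet B)
    (hA0 : A.Nonempty) (hB0 : B.Nonempty) (a b : ℝ) (ha : 0 < a) (hb : 0 < b)
    (h : ∀ x ∈ A, ∀ y ∈ B, a * x + b * y ∈ C) :
    ENNReal.ofReal a * volume A + ENNReal.ofReal b * volume B ≤ volume C := by
  have key : ∀ S ⊆ A, ∀ T ⊆ B, IsCompact S → IsCompact T → S.Nonempty → T.Nonempty →
      ENNReal.ofReal a * volume S + ENNReal.ofReal b * volume T ≤ volume C := by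
    intro S hS T hT hSc hTc hS0 hT0
    obtain ⟨k, hk, hkmax⟩ := hSc.exists_isMaxOn hS0 continuousOn_id
    obtain ⟨l, hl, hlmin⟩ := hTc.exists_isMinOn hT0 continuousOn_id
    set S' : Set ℝ := (fun x => a * x + b * l) '' S
    set T' : Set ℝ := (fun y => a * k + b * y) '' T
    have hvS : volume S' = ENNReal.ofReal a * volume S := by
      have : S' = (fun x => x + b * l) '' ((fun x => a • x) '' S) := by
        rw [Set.image_image]; rfl
      rw [this, Set.image_add_right, measure_preimage_add_right]
      change volume (a • S) = _
      rw [Measure.addHaar_smul]; simp [abs_of_pos ha]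
    have hvT : volume T' = ENNReal.ofReal b * volume T := by
      have : T' = (fun x => a * k + x) '' ((fun x => b • x) '' T) := by
        rw [Set.image_image]; rfl
      rw [this, Set.image_add_left, measure_preimage_add]
      change volume (b • T) = _
      rw [Measure.addHaar_smul]; simp [abs_of_pos hb]
    have hTm : MeasurableSet T' := (hTc.image (by fun_prop)).measurableSet
    have hdis : AEDisjoint volume S' T' := by
      refine measure_mono_null (t := {a * k + b * l}) ?_ (by simp)
      rintro z ⟨⟨x, hx, rfl⟩, ⟨y, hy, hxy⟩⟩
      have h1 : x ≤ k := hkmax hx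
      have h2 : l ≤ y := hlmin hy
      simp only at hxy
      have : a * x ≤ a * k := by gcongr
      have : b * l ≤ b * y := by gcongr
      simp only [Set.mem_singleton_iff]
      linarith
    rw [← hvS, ← hvT, ← measure_union₀ hTm.nullMeasurableSet hdis]
    apply measure_mono
    rintro z (⟨x, hx, rfl⟩ | ⟨y, hy, rfl⟩)
    · exact h _ (hS hx) _ (hT hl)
    · exact h _ (hS hk) _ (hT hy)
  obtain ⟨x0, hx0⟩ := hA0
  obtain ⟨y0, hy0⟩ := hB0
  rw [hA.measure_eq_iSup_isCompact, hB.measure_eq_iSup_isCompact]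
  simp only [ENNReal.mul_iSup]
  refine ENNReal.biSup_add_biSup_le' (p := fun S => S ⊆ A) (q := fun T => T ⊆ B) ⟨∅, by simp⟩ ⟨∅, by simp⟩ ?_
  intro S hS T hT
  by_cases hSc : IsCompact S
  swap
  · by_cases hTc : IsCompact T
    · have := key {x0} (by simpa using hx0) (insert y0 T) (Set.insert_subset hy0 hT)
        isCompact_singleton (hTc.insert y0) (by simp) (by simp)
      simp only [hSc, hTc, iSup_false, iSup_true]
      refine le_trans ?_ this
      simp only [ENNReal.bot_eq_zero]
      gcongr
      · exact zero_le
      · simp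
    · simp [hSc, hTc]
  by_cases hTc : IsCompact T
  swap
  · have := key (insert x0 S) (Set.insert_subset hx0 hS) {y0} (by simpa using hy0) 
        (hSc.insert x0) isCompact_singleton (by simp) (by simp)
    simp only [hSc, hTc, iSup_false, iSup_true]
    refine le_trans ?_ this
    simp only [ENNReal.bot_eq_zero]
    gcongr
    · simp
    · exact zero_le
  have := key (insert x0 S) (Set.insert_subset hx0 hS) (insert y0 T) (Set.insert_subset hy0 hT)
        (hSc.insert x0) (hTc.insert y0) (by simp) (by simp)
  simp only [hSc, hTc, iSup_true]
  refine le_trans ?_ this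
  gcongr <;> simp

lemma ennreal_geom_le_arith (a b : ℝ) (ha : 0 < a) (hb : 0 < b) (hab : a + b = 1)
    (x y : ℝ≥0∞) : x ^ a * y ^ b ≤ ENNReal.ofReal a * x + ENNReal.ofReal b * y := by
  rcases eq_or_ne x ⊤ with rfl | hx
  · rw [ENNReal.mul_top (by simpa using ha)]; simp
  rcases eq_or_ne y ⊤ with rfl | hy
  · rw [ENNReal.mul_top (a := ENNReal.ofReal b) (by simpa using hb)]; simp
  lift x to ℝ≥0 using hx
  lift y to ℝ≥0 using hy
  have := NNReal.geom_mean_le_arith_mean2_weighted a.toNNReal b.toNNReal x y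
    (by rw [← Real.toNNReal_add ha.le hb.le, hab]; simp)
  rw [Real.coe_toNNReal _ ha.le, Real.coe_toNNReal _ hb.le] at this
  rw [← ENNReal.coe_rpow_of_nonneg _ ha.le, ← ENNReal.coe_rpow_of_nonneg _ hb.le]
  unfold ENNReal.ofReal
  exact_mod_cast this

/-- One-dimensional Prékopa–Leindler, for functions with values in `[0,1]` and supremum `1`. -/
lemma pl_norm (f g h : ℝ → ℝ) (hf : Measurable f) (hg : Measurable g) (hh : Measurable h)
    (f0 : ∀ x, 0 ≤ f x) (g0 : ∀ x, 0 ≤ g x) (h0 : ∀ x, 0 ≤ h x)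
    (f1 : ∀ x, f x ≤ 1) (g1 : ∀ x, g x ≤ 1)
    (fs : ∀ t < 1, ∃ x, t < f x) (gs : ∀ t < 1, ∃ x, t < g x)
    (a b : ℝ) (ha : 0 < a) (hb : 0 < b) 
    (H : ∀ t, 0 < t → t < 1 → ∀ x y, t < f x → t < g y → t < h (a * x + b * y)) :
    ENNReal.ofReal a * (∫⁻ x, ENNReal.ofReal (f x)) + 
      ENNReal.ofReal b * (∫⁻ x, ENNReal.ofReal (g x)) ≤ ∫⁻ x, ENNReal.ofReal (h x) := by
  rw [lintegral_eq_lintegral_meas_lt volume (ae_of_all _ f0) hf.aemeasurable,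
    lintegral_eq_lintegral_meas_lt volume (ae_of_all _ g0) hg.aemeasurable,
    lintegral_eq_lintegral_meas_lt volume (ae_of_all _ h0) hh.aemeasurable]
  have anti : ∀ u : ℝ → ℝ, Measurable fun t : ℝ => volume {x | t < u x} := by
    intro u
    apply Antitone.measurable
    intro s t hst
    exact measure_mono fun x hx => lt_of_le_of_lt hst hx
  rw [← lintegral_const_mul _ (anti f), ← lintegral_const_mul _ (anti g),
    ← lintegral_add_left ((anti f).const_mul _)]
  refine setLIntegral_mono_ae ((anti h).aemeasurable) (ae_of_all _ fun t ht => ?_)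
  rcases lt_or_ge t 1 with h1 | h1
  · apply bm_one _ _ _ (measurableSet_lt measurable_const hf) (measurableSet_lt measurable_const hg) (fs t h1) (gs t h1) a b ha hb
    intro x hx y hy
    exact H t ht h1 x y hx hy
  · have e1 : {x | t < f x} = ∅ := by ext x; simpa using (f1 x).trans h1
    have e2 : {x | t < g x} = ∅ := by ext x; simpa using (g1 x).trans h1
    simp [e1, e2]

end Part1

section Part2
open scoped ENNReal NNReal Pointwise

/-- Log-concavity for `ℝ≥0∞`-valued functions. -/
def LogConc {E : Type*} [AddCommGroup E] [Module ℝ E] (F : E → ℝ≥0∞) : Prop :=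
  ∀ x y, ∀ a b : ℝ, 0 < a → 0 < b → a + b = 1 → F x ^ a * F y ^ b ≤ F (a • x + b • y)

lemma LogConc.measurable {f : ℝ → ℝ≥0∞} (hf : LogConc f) : Measurable f := by
  refine measurable_of_Ioi fun c => ?_
  apply Set.OrdConnected.measurableSet
  rw [← convex_iff_ordConnected (𝕜 := ℝ)]
  rw [convex_iff_forall_pos]
  intro x hx y hy a b ha hb hab
  have hx : c < f x := hx
  have hy : c < f y := hy
  have h1 : c < min (f x) (f y) := lt_min hx hy
  refine h1.trans_le (le_trans ?_ (hf x y a b ha hb hab))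
  calc min (f x) (f y) = (min (f x) (f y)) ^ (a + b) := by rw [hab]; simp
    _ = (min (f x) (f y)) ^ a * (min (f x) (f y)) ^ b := ENNReal.rpow_add_of_nonneg _ _ ha.le hb.le
    _ ≤ _ := by gcongr <;> simp

lemma pl_one (f g h : ℝ → ℝ≥0∞) (hf : Measurable f) (hg : Measurable g) (hh : Measurable h)
    (M : ℝ≥0∞) (hM : M ≠ ⊤) (fM : ∀ x, f x ≤ M) (gM : ∀ x, g x ≤ M) (a b : ℝ) (ha : 0 < a)
    (hb : 0 < b) (hab : a + b = 1) (H : ∀ x y, f x ^ a * g y ^ b ≤ h (a * x + b * y)) :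
    (∫⁻ x, f x) ^ a * (∫⁻ x, g x) ^ b ≤ ∫⁻ x, h x := by
  set F := ⨆ x, f x with hF
  set G := ⨆ x, g x with hG
  have hFt : F ≠ ⊤ := ne_top_of_le_ne_top hM (iSup_le fM)
  have hGt : G ≠ ⊤ := ne_top_of_le_ne_top hM (iSup_le gM)
  have fF : ∀ x, f x ≤ F := le_iSup f
  have gG : ∀ x, g x ≤ G := le_iSup g
  rcases eq_or_ne F 0 with hF0 | hF0
  · have : ∀ x, f x = 0 := fun x => le_antisymm (hF0 ▸ fF x) zero_le
    simp [this, ha]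
  rcases eq_or_ne G 0 with hG0 | hG0
  · have : ∀ x, g x = 0 := fun x => le_antisymm (hG0 ▸ gG x) zero_le
    simp [this, hb]
  set L := F ^ a * G ^ b with hL
  have hL0 : L ≠ 0 := by simp [hL, hF0, hG0, hFt, hGt, ENNReal.rpow_eq_zero_iff]
  have hLt : L ≠ ⊤ := ENNReal.mul_ne_top (ENNReal.rpow_ne_top_of_nonneg ha.le hFt) (ENNReal.rpow_ne_top_of_nonneg hb.le hGt)
  have tr : ∀ (f : ℝ → ℝ≥0∞) (F : ℝ≥0∞), F ≠ 0 → F ≠ ⊤ → (∀ x, f x ≤ F) → 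
     ∫⁻ x, f x = F * ∫⁻ x, ENNReal.ofReal ((f x / F).toReal) := by
    intro f F h0 ht hfF
    rw [← lintegral_const_mul' _ _ ht]
    congr 1; ext x
    rw [ENNReal.ofReal_toReal (ENNReal.div_ne_top (ne_top_of_le_ne_top ht (hfF x)) h0), ENNReal.mul_div_cancel h0 ht]
  have lt_iff : ∀ (u F : ℝ≥0∞), F ≠ 0 → F ≠ ⊤ → u ≠ ⊤ → ∀ t : ℝ, 0 ≤ t → (t < (u / F).toReal ↔ ENNReal.ofReal t * F < u) := by
    intro u F h0 ht hu t ht0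
    rw [← ENNReal.ofReal_lt_iff_lt_toReal ht0 (ENNReal.div_ne_top hu h0), ENNReal.lt_div_iff_mul_lt (Or.inl h0) (Or.inl ht)]
  have fs : ∀ t < (1:ℝ), ∃ x, t < (f x / F).toReal := by
    intro t ht
    have h1 : ENNReal.ofReal (max t 0) * F < F := by
      calc _ < 1 * F := by
            apply ENNReal.mul_lt_mul_left hF0 hFt
            rw [← ENNReal.ofReal_one]
            rw [ENNReal.ofReal_lt_ofReal_iff one_pos]; exact max_lt ht one_pos
        _ = F := one_mul _
    obtain ⟨x, hx⟩ := lt_iSup_iff.1 (hF ▸ h1)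
    refine ⟨x, lt_of_le_of_lt (le_max_left t 0) ?_⟩
    exact (lt_iff _ _ hF0 hFt (ne_top_of_le_ne_top hFt (fF x)) _ (le_max_right _ _)).2 hx
  have gs : ∀ t < (1:ℝ), ∃ x, t < (g x / G).toReal := by
    intro t ht
    have h1 : ENNReal.ofReal (max t 0) * G < G := by
      calc _ < 1 * G := by
            apply ENNReal.mul_lt_mul_left hG0 hGt
            rw [← ENNReal.ofReal_one]
            rw [ENNReal.ofReal_lt_ofReal_iff one_pos]; exact max_lt ht one_pos
        _ = G := one_mul _
    obtain ⟨x, hx⟩ := lt_iSup_iff.1 (hG ▸ h1)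
    refine ⟨x, lt_of_le_of_lt (le_max_left t 0) ?_⟩
    exact (lt_iff _ _ hG0 hGt (ne_top_of_le_ne_top hGt (gG x)) _ (le_max_right _ _)).2 hx
  have one : ∀ (u F : ℝ≥0∞), F ≠ 0 → F ≠ ⊤ → u ≤ F → (u / F).toReal ≤ 1 := by
    intro u F h0 ht h
    have : u / F ≤ 1 := ENNReal.div_le_of_le_mul (by simpa using h)
    simpa using ENNReal.toReal_mono ENNReal.one_ne_top this
  have main := pl_norm (fun x => (f x / F).toReal) (fun x => (g x / G).toReal)
    (fun x => (min (h x) L / L).toReal) (by fun_prop) (by fun_prop) (by fun_prop)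
    (fun x => by positivity) (fun x => by positivity) (fun x => by positivity)
    (fun x => one _ _ hF0 hFt (fF x)) (fun x => one _ _ hG0 hGt (gG x)) fs gs a b ha hb ?_
  · rw [tr f F hF0 hFt fF, tr g G hG0 hGt gG, ENNReal.mul_rpow_of_nonneg _ _ ha.le,
      ENNReal.mul_rpow_of_nonneg _ _ hb.le, mul_mul_mul_comm, ← hL]
    calc _ ≤ L * _ := mul_le_mul_right ((ennreal_geom_le_arith a b ha hb hab _ _).trans main) L
      _ = ∫⁻ x, min (h x) L := (tr (fun x => min (h x) L) L hL0 hLt (fun x => min_le_right _ _)).symm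
      _ ≤ _ := lintegral_mono fun x => min_le_left _ _
  · intro t ht0 ht1 x y hx hy
    rw [lt_iff _ _ hF0 hFt (ne_top_of_le_ne_top hFt (fF x)) _ ht0.le] at hx
    rw [lt_iff _ _ hG0 hGt (ne_top_of_le_ne_top hGt (gG y)) _ ht0.le] at hy
    rw [lt_iff _ _ hL0 hLt (ne_top_of_le_ne_top hLt (min_le_right _ _)) _ ht0.le]
    apply lt_min
    · refine lt_of_lt_of_le ?_ (H x y)
      have e : ENNReal.ofReal t * L = (ENNReal.ofReal t * F) ^ a * (ENNReal.ofReal t * G) ^ b := by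
        rw [ENNReal.mul_rpow_of_nonneg _ _ ha.le,
          ENNReal.mul_rpow_of_nonneg _ _ hb.le, mul_mul_mul_comm, ← hL, 
          ← ENNReal.rpow_add_of_nonneg _ _ ha.le hb.le, hab, ENNReal.rpow_one]
      rw [e]
      exact ENNReal.mul_lt_mul (ENNReal.rpow_lt_rpow hx ha) (ENNReal.rpow_lt_rpow hy hb)
    · calc _ < 1 * L := by
            apply ENNReal.mul_lt_mul_left hL0 hLt
            rw [← ENNReal.ofReal_one]
            rw [ENNReal.ofReal_lt_ofReal_iff one_pos]; exact ht1
        _ = L := one_mul _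

lemma logConc_gaussianPDF : LogConc (gaussianPDF 0 1) := by
  intro x y a b ha hb hab
  have hp := fun z => gaussianPDFReal_pos 0 1 z one_ne_zero
  unfold gaussianPDF
  rw [ENNReal.ofReal_rpow_of_pos (hp x), ENNReal.ofReal_rpow_of_pos (hp y),
    ← ENNReal.ofReal_mul (by have := hp x; positivity)]
  apply ENNReal.ofReal_le_ofReal
  unfold gaussianPDFReal
  have hc : 0 < (√(2 * Real.pi * (1:ℝ≥0)))⁻¹ := by simp; positivity
  rw [Real.mul_rpow hc.le (Real.exp_pos _).le, Real.mul_rpow hc.le (Real.exp_pos _).le,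
    mul_mul_mul_comm, ← Real.rpow_add hc, hab, Real.rpow_one, ← Real.exp_mul, ← Real.exp_mul,
    ← Real.exp_add]
  gcongr
  obtain rfl : b = 1 - a := by linarith
  simp only [smul_eq_mul, NNReal.coe_one]
  nlinarith [mul_nonneg (mul_nonneg ha.le hb.le) (sq_nonneg (x - y))]

lemma LogConc.marg {E : Type*} [AddCommGroup E] [Module ℝ E] {F : E × ℝ → ℝ≥0∞} (hF : LogConc F)
    (h1 : ∀ p, F p ≤ 1) : LogConc (fun x => ∫⁻ t, F (x, t) ∂(gaussianReal 0 1)) := by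
  have hm : ∀ x, Measurable fun t => F (x, t) := by
    intro x
    apply LogConc.measurable
    intro s t a b ha hb hab
    have := hF (x, s) (x, t) a b ha hb hab
    rwa [Prod.smul_mk, Prod.smul_mk, Prod.mk_add_mk, ← add_smul, hab, one_smul] at this
  intro x y a b ha hb hab
  simp only [gaussianReal_of_var_ne_zero 0 one_ne_zero]
  have hg := measurable_gaussianPDF 0 1
  have e : ∀ x, ∫⁻ t, F (x, t) ∂(volume.withDensity (gaussianPDF 0 1)) = ∫⁻ t, gaussianPDF 0 1 t * F (x, t) := by
    intro x
    rw [lintegral_withDensity_eq_lintegral_mul _ hg (hm x)]; rfl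
  rw [e, e, e]
  have bd : ∀ x, gaussianPDF 0 1 x ≤ ENNReal.ofReal 1 := by
    intro x
    apply ENNReal.ofReal_le_ofReal
    unfold gaussianPDFReal
    have h1 : (√(2 * Real.pi * (1:ℝ≥0)))⁻¹ ≤ 1 := by
      apply inv_le_one_of_one_le₀
      rw [Real.one_le_sqrt]
      have := Real.pi_gt_three
      simp; linarith
    have h2 : Real.exp (-(x - 0) ^ 2 / (2 * (1:ℝ≥0))) ≤ 1 := by
      rw [Real.exp_le_one_iff]
      have := sq_nonneg x
      simp; linarith
    calc _ ≤ 1 * (1:ℝ) := by gcongr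
      _ = 1 := by simp
  refine pl_one _ _ _ (hg.mul (hm x)) (hg.mul (hm y)) (hg.mul (hm _)) (ENNReal.ofReal 1) (by simp)
    (fun t => ?_) (fun t => ?_) a b ha hb hab ?_
  · calc _ ≤ ENNReal.ofReal 1 * 1 := mul_le_mul' (bd t) (h1 _)
      _ = _ := by simp
  · calc _ ≤ ENNReal.ofReal 1 * 1 := mul_le_mul' (bd t) (h1 _)
      _ = _ := by simp
  intro s t
  simp only [Pi.mul_apply]
  rw [ENNReal.mul_rpow_of_nonneg _ _ ha.le,
          ENNReal.mul_rpow_of_nonneg _ _ hb.le, mul_mul_mul_comm]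
  exact mul_le_mul' (logConc_gaussianPDF s t a b ha hb hab) (hF (x, s) (y, t) a b ha hb hab)

lemma LogConc.marg_pi (m : ℕ) {E : Type*} [AddCommGroup E] [Module ℝ E] {F : E × (Fin m → ℝ) → ℝ≥0∞}
    (hF : LogConc F) (h1 : ∀ p, F p ≤ 1) (hm : ∀ x, Measurable fun z => F (x, z)) :
    LogConc (fun x => ∫⁻ z, F (x, z) ∂(Measure.pi fun _ : Fin m => gaussianReal 0 1)) := by
  induction m generalizing E with
  | zero =>
    intro x y a b ha hb hab
    have e : (Measure.pi fun _ : Fin 0 => gaussianReal 0 1) = Measure.dirac 0 := by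
      rw [Measure.pi_of_empty]
      congr 1
      exact Subsingleton.elim _ _
    simp only [e, lintegral_dirac]
    refine (hF _ _ a b ha hb hab).trans_eq ?_
    congr 1
    exact Prod.ext rfl (Subsingleton.elim _ _)
  | succ m ih =>
    have mp := measurePreserving_piFinSuccAbove (fun _ : Fin (m+1) => gaussianReal 0 1) 0
    have e : ∀ x, ∫⁻ z, F (x, z) ∂(Measure.pi fun _ : Fin (m+1) => gaussianReal 0 1)
        = ∫⁻ z, ∫⁻ t, F (x, (MeasurableEquiv.piFinSuccAbove (fun _ => ℝ) 0).symm (t, z)) ∂(gaussianReal 0 1)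
          ∂(Measure.pi fun _ : Fin m => gaussianReal 0 1) := by
      intro x
      rw [← (mp.symm).lintegral_comp (hm x)]
      rw [lintegral_prod_symm']
      exact (hm x).comp (MeasurableEquiv.measurable _)
    simp only [e]
    refine ih (F := fun p => ∫⁻ t, F (p.1, (MeasurableEquiv.piFinSuccAbove (fun _ => ℝ) 0).symm (t, p.2)) ∂(gaussianReal 0 1)) ?_ ?_ ?_
    · refine LogConc.marg (F := fun q : (E × (Fin m → ℝ)) × ℝ => F (q.1.1, (MeasurableEquiv.piFinSuccAbove (fun _ => ℝ) 0).symm (q.2, q.1.2))) ?_ ?_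
      · intro p q a b ha hb hab
        refine (hF _ _ a b ha hb hab).trans_eq ?_
        congr 1
        refine Prod.ext rfl ?_
        ext i
        refine Fin.cases ?_ (fun j => ?_) i <;> simp [MeasurableEquiv.piFinSuccAbove, Fin.insertNthEquiv]
      · intro p; exact h1 _
    · intro p
      calc _ ≤ ∫⁻ t, 1 ∂(gaussianReal 0 1) := lintegral_mono fun t => h1 _
        _ = 1 := by simp
    · intro x
      apply Measurable.lintegral_prod_left' (f := fun q : ℝ × (Fin m → ℝ) => F (x, (MeasurableEquiv.piFinSuccAbove (fun _ => ℝ) 0).symm q))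
      exact (hm x).comp (MeasurableEquiv.measurable _)

end Part2

section Part3
open scoped ENNReal NNReal Pointwise

lemma cheb_slab (ν : Measure ℝ) [IsProbabilityMeasure ν] (f : ℝ → ℝ≥0∞) (S : Set ℝ)
    (hS : MeasurableSet S) (c : ℝ≥0∞) (h1 : ∀ s ∈ S, c ≤ f s) (h2 : ∀ s ∉ S, f s ≤ c) :
    (∫⁻ s, f s ∂ν) * ν S ≤ ∫⁻ s in S, f s ∂ν := by
  have e1 : c * ν S ≤ ∫⁻ s in S, f s ∂ν := by
    rw [← setLIntegral_const]
    exact setLIntegral_mono' hS h1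
  have e2 : ∫⁻ s in Sᶜ, f s ∂ν ≤ c * ν Sᶜ := by
    rw [← setLIntegral_const]
    exact setLIntegral_mono' hS.compl h2
  have e3 : ν S + ν Sᶜ = 1 := prob_add_prob_compl hS
  calc (∫⁻ s, f s ∂ν) * ν S = (∫⁻ s in S, f s ∂ν) * ν S + (∫⁻ s in Sᶜ, f s ∂ν) * ν S := by
        rw [← add_mul, lintegral_add_compl _ hS]
    _ ≤ (∫⁻ s in S, f s ∂ν) * ν S + (c * ν Sᶜ) * ν S := by gcongr
    _ = (∫⁻ s in S, f s ∂ν) * ν S + (c * ν S) * ν Sᶜ := by ring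
    _ ≤ (∫⁻ s in S, f s ∂ν) * ν S + (∫⁻ s in S, f s ∂ν) * ν Sᶜ := by gcongr
    _ = _ := by rw [← mul_add, e3, mul_one]

lemma slab_pi (m : ℕ) (C : Set (ℝ × (Fin m → ℝ))) (hC : Convex ℝ C) (hCm : MeasurableSet C)
    (hs : ∀ p ∈ C, -p ∈ C) (r : ℝ) :
    ((gaussianReal 0 1).prod (Measure.pi fun _ : Fin m => gaussianReal 0 1)) C *
      (gaussianReal 0 1) {s | |s| ≤ r} ≤
    ((gaussianReal 0 1).prod (Measure.pi fun _ : Fin m => gaussianReal 0 1)) (C ∩ {p | |p.1| ≤ r}) := by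
  set γ := gaussianReal 0 1
  set γm := Measure.pi fun _ : Fin m => gaussianReal 0 1
  have hneg : MeasurePreserving (fun z : Fin m → ℝ => -z) γm γm := by
    refine measurePreserving_pi (f := fun _ x => -x) _ _ fun i => ⟨by fun_prop, ?_⟩
    rw [gaussianReal_map_neg]; simp
  set f : ℝ → ℝ≥0∞ := fun s => γm (Prod.mk s ⁻¹' C) with hf
  have flc : LogConc f := by
    have := LogConc.marg_pi m (F := C.indicator (fun _ => (1:ℝ≥0∞))) ?_ ?_ ?_
    · convert this using 1
      ext s
      simp only [hf]
      rw [← lintegral_indicator_one (measurable_prodMk_left hCm)]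
      rfl
    · intro p q a b ha hb hab
      by_cases hp : p ∈ C
      · by_cases hq : q ∈ C
        · simp [hp, hq, hC hp hq ha.le hb.le hab]
        · simp [hq, hb]
      · simp [hp, ha]
    · intro p; exact Set.indicator_le_self' (by simp) p |>.trans (by simp)
    · intro x
      exact (measurable_const.indicator hCm).comp measurable_prodMk_left
  have feven : ∀ s, f (-s) = f s := by
    intro s
    simp only [hf]
    rw [← hneg.measure_preimage (measurable_prodMk_left hCm).nullMeasurableSet]
    congr 1
    ext z
    simp only [Set.mem_preimage]
    constructor
    · intro h; simpa using hs _ h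
    · intro h; simpa using hs _ h
  have fdec : ∀ s t, |s| ≤ |t| → f t ≤ f s := by
    intro s t hst
    rcases hst.eq_or_lt with h | h
    · rcases abs_eq_abs.1 h with rfl | rfl
      · exact le_rfl
      · rw [feven]
    · have ht : t ≠ 0 := by rintro rfl; simp at h; exact absurd h (not_lt.2 (abs_nonneg s))
      have h3 : |s / t| < 1 := by
        rw [abs_div, div_lt_one (lt_of_le_of_lt (abs_nonneg _) h)]; exact h
      rw [abs_lt] at h3
      have := flc t (-t) ((1 + s / t) / 2) ((1 - s / t) / 2) (by linarith) (by linarith) (by ring)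
      rw [feven, ← ENNReal.rpow_add_of_nonneg _ _ (by linarith) (by linarith)] at this
      have e1 : (1 + s / t) / 2 + (1 - s / t) / 2 = 1 := by ring
      have e2 : ((1 + s / t) / 2) • t + ((1 - s / t) / 2) • -t = s := by
        simp only [smul_eq_mul]; field_simp; ring
      rwa [e1, e2, ENNReal.rpow_one] at this
  have hSm : MeasurableSet {s : ℝ | |s| ≤ r} := measurableSet_le (by fun_prop) (by fun_prop)
  rcases lt_or_ge r 0 with hr | hr
  · have : {s : ℝ | |s| ≤ r} = ∅ := by
      ext s; simp only [Set.mem_ofPred_eq, Set.mem_empty_iff_false, iff_false, not_le]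
      exact hr.trans_le (abs_nonneg s)
    simp [this]
  have := cheb_slab γ f {s | |s| ≤ r} hSm (f r)
    (fun s hs => fdec s r (by rw [abs_of_nonneg hr]; exact hs))
    (fun s hs => fdec r s (by rw [abs_of_nonneg hr]; exact (not_le.1 hs).le))
  have hm2 : MeasurableSet (C ∩ {p : ℝ × (Fin m → ℝ) | |p.1| ≤ r}) := hCm.inter (hSm.preimage measurable_fst)
  rw [Measure.prod_apply hCm, Measure.prod_apply hm2]
  refine this.trans_eq ?_
  rw [← lintegral_indicator hSm]
  congr 1
  ext s
  by_cases h : s ∈ {s : ℝ | |s| ≤ r}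
  · rw [Set.indicator_of_mem h]
    simp only [hf]
    congr 1
    ext z
    simp only [Set.mem_preimage, Set.mem_inter_iff, Set.mem_ofPred_eq]
    exact ⟨fun h' => ⟨h', h⟩, fun h' => h'.1⟩
  · rw [Set.indicator_of_notMem h]
    symm
    convert measure_empty (μ := γm)
    ext z
    simp only [Set.mem_preimage, Set.mem_inter_iff, Set.mem_ofPred_eq, Set.mem_empty_iff_false, iff_false, not_and]
    exact fun _ => h

lemma slab_std {E : Type*} [NormedAddCommGroup E] [InnerProductSpace ℝ E] [FiniteDimensional ℝ E]
    [MeasurableSpace E] [BorelSpace E] (C : Set E) (hC : Convex ℝ C) (hCm : MeasurableSet C)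
    (hs : ∀ p ∈ C, -p ∈ C) (l : E) (r : ℝ) :
    stdGaussian E C * stdGaussian E {z | |inner ℝ l z| ≤ r} ≤ stdGaussian E (C ∩ {z | |inner ℝ l z| ≤ r}) := by
  rcases eq_or_ne l 0 with rfl | hl
  · by_cases hr : 0 ≤ r <;> simp [hr]
  have : Nontrivial E := ⟨l, 0, hl⟩
  obtain ⟨m, hm⟩ : ∃ m, Module.finrank ℝ E = m + 1 := Nat.exists_eq_succ_of_ne_zero (Module.finrank_pos).ne'
  obtain ⟨b, hb⟩ := Orthonormal.exists_orthonormalBasis_extension_of_card_eq (𝕜 := ℝ) (E := E)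
    (ι := Fin (m+1)) (by simpa using hm) (v := fun _ => ‖l‖⁻¹ • l) (s := {0}) (by
      constructor
      · rintro ⟨i, hi⟩
        simp [norm_smul, hl]
      · rintro ⟨i, hi⟩ ⟨j, hj⟩ hij
        simp at hi hj
        subst hi; subst hj
        exact absurd rfl hij)
  have hb0 : b 0 = ‖l‖⁻¹ • l := hb 0 rfl
  have hl' : l = ‖l‖ • b 0 := by rw [hb0, smul_smul, mul_inv_cancel₀ (norm_ne_zero_iff.2 hl), one_smul]
  set T : (Fin (m+1) → ℝ) → E := fun x => ∑ i, x i • b i with hT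
  have hTm : Measurable T := by fun_prop
  set e := MeasurableEquiv.piFinSuccAbove (fun _ : Fin (m+1) => ℝ) 0
  have mp := measurePreserving_piFinSuccAbove (fun _ : Fin (m+1) => gaussianReal 0 1) 0
  have key : ∀ A, MeasurableSet A → stdGaussian E A =
      ((gaussianReal 0 1).prod (Measure.pi fun _ : Fin m => gaussianReal 0 1)) ((fun p => T (e.symm p)) ⁻¹' A) := by
    intro A hA
    rw [stdGaussian_eq_map_pi_orthonormalBasis b, Measure.map_apply hTm hA,
      ← mp.symm.measure_preimage (hTm hA).nullMeasurableSet]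
    rfl
  have hin : ∀ p, inner ℝ l (T (e.symm p)) = ‖l‖ * p.1 := by
    intro p
    rw [hT]
    simp only
    rw [inner_sum]
    simp only [inner_smul_right]
    rw [Finset.sum_eq_single 0]
    · nth_rewrite 1 [hl']
      rw [inner_smul_left]
      simp [e, MeasurableEquiv.piFinSuccAbove, Fin.insertNthEquiv]
      ring
    · intro j _ hj
      nth_rewrite 1 [hl']
      rw [inner_smul_left, b.inner_eq_zero hj.symm]; simp
    · simp
  have lin1 : ∀ p q : ℝ × (Fin m → ℝ), ∀ a c : ℝ, T (e.symm (a • p + c • q)) = a • T (e.symm p) + c • T (e.symm q) := by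
    intro p q a c
    simp only [hT, Finset.smul_sum, ← Finset.sum_add_distrib]
    congr 1; ext i
    rw [smul_smul, smul_smul, ← add_smul]
    congr 1
    refine Fin.cases ?_ (fun j => ?_) i <;> simp [e, MeasurableEquiv.piFinSuccAbove, Fin.insertNthEquiv]
  have hSm : MeasurableSet {z : E | |inner ℝ l z| ≤ r} := measurableSet_le (by fun_prop) (by fun_prop)
  have hpos : 0 < ‖l‖ := norm_pos_iff.2 hl
  have hpre : (fun p => T (e.symm p)) ⁻¹' {z : E | |inner ℝ l z| ≤ r} = {p | |p.1| ≤ r / ‖l‖} := by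
    ext p
    simp only [Set.mem_preimage, Set.mem_ofPred_eq, hin]
    rw [abs_mul, abs_of_pos hpos, le_div_iff₀ hpos, mul_comm]
  rw [key _ hCm, key _ hSm, key _ (hCm.inter hSm), Set.preimage_inter, hpre]
  have := slab_pi m ((fun p => T (e.symm p)) ⁻¹' C) ?_ ?_ ?_ (r / ‖l‖)
  · refine le_trans (le_of_eq ?_) this
    congr 1
    have hS' : MeasurableSet {s : ℝ | |s| ≤ r / ‖l‖} := measurableSet_le (by fun_prop) (by fun_prop)
    have : {p : ℝ × (Fin m → ℝ) | |p.1| ≤ r / ‖l‖} = {s : ℝ | |s| ≤ r / ‖l‖} ×ˢ Set.univ := by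
      ext p; simp
    rw [this, Measure.prod_prod]; simp
  · intro p hp q hq a c ha hc hac
    simp only [Set.mem_preimage] at *
    rw [lin1]
    exact hC hp hq ha hc hac
  · exact hCm.preimage (hTm.comp e.symm.measurable)
  · intro p hp
    simp only [Set.mem_preimage] at *
    have := lin1 p 0 (-1) 0
    simp only [neg_smul, one_smul, zero_smul, add_zero] at this
    rw [this]
    exact hs _ hp

lemma sidak_std {E : Type*} [NormedAddCommGroup E] [InnerProductSpace ℝ E] [FiniteDimensional ℝ E]
    [MeasurableSpace E] [BorelSpace E] {ι : Type*} (s : Finset ι) (l : ι → E) (r : ι → ℝ) :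
    ∏ i ∈ s, stdGaussian E {z | |inner ℝ (l i) z| ≤ r i} ≤
      stdGaussian E {z | ∀ i ∈ s, |inner ℝ (l i) z| ≤ r i} := by
  classical
  induction s using Finset.induction_on with
  | empty => simp
  | insert i s hi ih =>
    rw [Finset.prod_insert hi, mul_comm]
    refine (mul_le_mul_left ih _).trans ?_
    refine (slab_std _ ?_ ?_ ?_ (l i) (r i)).trans (measure_mono ?_)
    · intro p hp q hq a c ha hc hac j hj
      have h1 := hp j hj
      have h2 := hq j hj
      rw [inner_add_right, inner_smul_right, inner_smul_right]
      calc _ ≤ |a * inner ℝ (l j) p| + |c * inner ℝ (l j) q| := abs_add_le _ _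
        _ = a * |inner ℝ (l j) p| + c * |inner ℝ (l j) q| := by
          rw [abs_mul, abs_mul, abs_of_nonneg ha, abs_of_nonneg hc]
        _ ≤ a * r j + c * r j := by gcongr
        _ = r j := by rw [← add_mul, hac, one_mul]
    · have : {z : E | ∀ i ∈ s, |inner ℝ (l i) z| ≤ r i} = ⋂ i ∈ s, {z : E | |inner ℝ (l i) z| ≤ r i} := by
        ext z; simp
      rw [this]
      exact Finset.measurableSet_biInter _ fun i _ => measurableSet_le (by fun_prop) (by fun_prop)
    · intro p hp j hj
      rw [inner_neg_right, abs_neg]; exact hp j hj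
    · rintro z ⟨h1, h2⟩ j hj
      rcases Finset.mem_insert.1 hj with rfl | hj
      · exact h2
      · exact h1 j hj

open scoped MatrixOrder Matrix.Norms.L2Operator in
/-- The Sidak inequality. -/
lemma sidak {Ω : Type*} [MeasurableSpace Ω] (μ : Measure Ω) [IsProbabilityMeasure μ]
    {ι : Type*} [Fintype ι] (X : ι → Ω → ℝ) (hX : ∀ i, AEMeasurable (X i) μ)
    (hg : ∀ a : ι → ℝ, ∃ v, μ.map (fun ω => ∑ i, a i * X i ω) = gaussianReal 0 v) (r : ι → ℝ) :
    ∏ i, μ {ω | |X i ω| ≤ r i} ≤ μ {ω | ∀ i, |X i ω| ≤ r i} := by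
  classical
  set Y : Ω → EuclideanSpace ℝ ι := fun ω => WithLp.toLp 2 (fun i => X i ω) with hY
  have hYm : AEMeasurable Y μ := by
    have : AEMeasurable (fun ω i => X i ω) μ := aemeasurable_pi_lambda _ hX
    exact (WithLp.measurable_toLp 2 (ι → ℝ)).comp_aemeasurable this
  set ν := μ.map Y with hν
  have hL : ∀ L : EuclideanSpace ℝ ι →L[ℝ] ℝ, ∃ v, ν.map L = gaussianReal 0 v := by
    intro L
    obtain ⟨v, hv⟩ := hg (fun i => L (EuclideanSpace.single i 1))
    refine ⟨v, ?_⟩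
    rw [← hv, hν, AEMeasurable.map_map_of_aemeasurable (by fun_prop) hYm]
    congr 1
    ext ω
    have : Y ω = ∑ i, X i ω • EuclideanSpace.single i (1:ℝ) := by
      ext j; simp [hY, Finset.sum_apply, Pi.single_apply]
    simp only [Function.comp_apply]
    rw [this, map_sum]
    congr 1; ext i
    rw [map_smul, smul_eq_mul, mul_comm]
  have hG : IsGaussian ν := isGaussian_of_map_eq_gaussianReal fun L => by
    obtain ⟨v, hv⟩ := hL L; exact ⟨0, v, hv⟩
  have hmean : ν[id] = 0 := by
    ext i
    have h1 : (∫ x, id x ∂ν) i = EuclideanSpace.proj (𝕜 := ℝ) i (∫ x, id x ∂ν) := rfl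
    rw [h1, ← ContinuousLinearMap.integral_comp_comm _ IsGaussian.integrable_id]
    obtain ⟨v, hv⟩ := hL (EuclideanSpace.proj (𝕜 := ℝ) i)
    have : ∫ x, x ∂(ν.map (EuclideanSpace.proj (𝕜 := ℝ) i)) = 0 := by rw [hv]; simp
    rw [integral_map (by fun_prop) (by fun_prop)] at this
    simpa using this
  set S : Matrix ι ι ℝ := fun i j => covarianceBilin ν (EuclideanSpace.basisFun ι ℝ i) (EuclideanSpace.basisFun ι ℝ j) with hS
  have hexp : ∀ x y : EuclideanSpace ℝ ι, covarianceBilin ν x y = x ⬝ᵥ S.mulVec y := by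
    intro x y
    have hx : x = ∑ i, x i • EuclideanSpace.basisFun ι ℝ i := by
      ext j; simp [Finset.sum_apply, Pi.single_apply]
    have hy : y = ∑ i, y i • EuclideanSpace.basisFun ι ℝ i := by
      ext j; simp [Finset.sum_apply, Pi.single_apply]
    conv_lhs => rw [hx, hy]
    simp only [map_sum, map_smul, sum_apply, smul_apply, smul_eq_mul,
      dotProduct, Matrix.mulVec, Finset.mul_sum, hS]
    rw [Finset.sum_comm]
    refine Finset.sum_congr rfl fun i _ => Finset.sum_congr rfl fun j _ => ?_
    ring
  have hSp : S.PosSemidef := by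
    refine Matrix.PosSemidef.of_dotProduct_mulVec_nonneg ?_ ?_
    · refine Matrix.IsHermitian.ext fun i j => ?_
      simp only [hS, star_trivial]
      exact covarianceBilin_comm _ _
    · intro x
      have := covarianceBilin_self_nonneg (μ := ν) (WithLp.toLp 2 x)
      rw [hexp] at this
      simpa using this
  have hνeq : ν = multivariateGaussian 0 S := by
    apply IsGaussian.ext
    · rw [hmean]; simp
    · ext x y
      rw [covarianceBilin_multivariateGaussian hSp, hexp]
  set A := Matrix.toEuclideanCLM (𝕜 := ℝ) (CFC.sqrt S)
  have hν2 : ν = (stdGaussian (EuclideanSpace ℝ ι)).map A := by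
    rw [hνeq, multivariateGaussian]; congr 1; ext x : 1; simp [A]
  set l : ι → EuclideanSpace ℝ ι := fun i => A.adjoint (EuclideanSpace.basisFun ι ℝ i)
  have hl : ∀ i z, inner ℝ (l i) z = (A z) i := by
    intro i z
    simp only [l]
    rw [ContinuousLinearMap.adjoint_inner_left]
    simp [EuclideanSpace.inner_single_left]
  have ms : ∀ i, MeasurableSet {x : EuclideanSpace ℝ ι | |x i| ≤ r i} := fun i =>
    measurableSet_le (by fun_prop) (by fun_prop)
  have e1 : ∀ i, μ {ω | |X i ω| ≤ r i} = stdGaussian _ {z | |inner ℝ (l i) z| ≤ r i} := by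
    intro i
    have h1 : μ {ω | |X i ω| ≤ r i} = ν {x | |x i| ≤ r i} := by
      rw [hν, Measure.map_apply_of_aemeasurable hYm (ms i)]; rfl
    rw [h1, hν2, Measure.map_apply (by fun_prop) (ms i)]
    simp only [hl]; rfl
  have e2 : μ {ω | ∀ i, |X i ω| ≤ r i} = stdGaussian _ {z | ∀ i ∈ Finset.univ, |inner ℝ (l i) z| ≤ r i} := by
    have ms2 : MeasurableSet {x : EuclideanSpace ℝ ι | ∀ i, |x i| ≤ r i} := by
      have : {x : EuclideanSpace ℝ ι | ∀ i, |x i| ≤ r i} = ⋂ i, {x | |x i| ≤ r i} := by ext; simp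
      rw [this]; exact MeasurableSet.iInter ms
    have h1 : μ {ω | ∀ i, |X i ω| ≤ r i} = ν {x | ∀ i, |x i| ≤ r i} := by
      rw [hν, Measure.map_apply_of_aemeasurable hYm ms2]; rfl
    rw [h1, hν2, Measure.map_apply (by fun_prop) ms2]
    simp only [hl, Finset.mem_univ, true_implies]; rfl
  simp only [e1, e2]
  exact sidak_std Finset.univ l r

end Part3

section Part4
open scoped ENNReal NNReal Pointwise

section process
variable {Ω : Type*} [MeasurableSpace Ω] {μ : Measure Ω} [IsProbabilityMeasure μ] {H K : ℝ}
  {B : ℝ → Ω → ℝ}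

lemma bif_map (hB : IsBifBM μ H K B) {ι : Type*} [Fintype ι] (t : ι → ℝ) (ht : ∀ i, 0 ≤ t i) (a : ι → ℝ) :
    Measure.map (fun ω => ∑ i, a i * B (t i) ω) μ =
      gaussianReal 0 (Real.toNNReal (∑ i, ∑ j, a i * a j * Rbif H K (t i) (t j))) := by
  have e := Fintype.equivFin ι
  have := hB.2 _ (t ∘ e.symm) (fun i => ht _) (a ∘ e.symm)
  simp only [Function.comp_apply] at this
  have h1 : ∀ ω, ∑ i, a (e.symm i) * B (t (e.symm i)) ω = ∑ i, a i * B (t i) ω :=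
    fun ω => e.symm.sum_comp (fun i => a i * B (t i) ω)
  have h2 : ∑ i, ∑ j, a (e.symm i) * a (e.symm j) * Rbif H K (t (e.symm i)) (t (e.symm j))
      = ∑ i, ∑ j, a i * a j * Rbif H K (t i) (t j) := by
    rw [← e.symm.sum_comp (fun i => ∑ j, a i * a j * Rbif H K (t i) (t j))]
    refine Finset.sum_congr rfl fun i _ => ?_
    exact e.symm.sum_comp (fun j => a (e.symm i) * a j * Rbif H K (t (e.symm i)) (t j))
  simp only [h1, h2] at this
  exact this

lemma bif_aem (hB : IsBifBM μ H K B) {t : ℝ} (ht : 0 ≤ t) : AEMeasurable (B t) μ := by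
  have := bif_map hB (ι := Unit) (fun _ => t) (fun _ => ht) (fun _ => 1)
  simp only [Finset.univ_unique, Finset.sum_singleton, one_mul] at this
  by_contra h
  have h0 := Measure.map_of_not_aemeasurable h
  have h1 : Measure.map (fun ω => B t ω) μ = 0 := h0
  rw [h1] at this
  exact (IsProbabilityMeasure.ne_zero (gaussianReal 0 _)) this.symm

/-- increments: joint linear combinations -/
lemma bif_incr_map (hB : IsBifBM μ H K B) {ι : Type*} [Fintype ι] (s t : ι → ℝ) (hs : ∀ i, 0 ≤ s i)
    (ht : ∀ i, 0 ≤ t i) (a : ι → ℝ) :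
    ∃ v, Measure.map (fun ω => ∑ i, a i * (B (t i) ω - B (s i) ω)) μ = gaussianReal 0 v := by
  have := bif_map hB (Sum.elim t s) (by rintro (i | i) <;> simp [hs, ht]) (Sum.elim a (-a))
  refine ⟨_, Eq.trans ?_ this⟩
  congr 1
  ext ω
  simp only [Fintype.sum_sum_type, Sum.elim_inl, Sum.elim_inr, ← Finset.sum_add_distrib]
  refine Finset.sum_congr rfl fun i _ => ?_
  simp; ring

lemma bif_incr_one (hB : IsBifBM μ H K B) {s t : ℝ} (hs : 0 ≤ s) (ht : 0 ≤ t) :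
    Measure.map (fun ω => B t ω - B s ω) μ = gaussianReal 0
      (Real.toNNReal (Rbif H K t t - Rbif H K t s - Rbif H K s t + Rbif H K s s)) := by
  have := bif_map hB ![t, s] (by intro i; fin_cases i <;> simp [hs, ht]) ![1, -1]
  simp only [Fin.sum_univ_two] at this
  convert this using 2
  · ext ω; simp; ring
  · congr 1; simp; ring

lemma Rbif_var_le (hH : H ∈ Set.Ioo (0:ℝ) 1) (hK : K ∈ Set.Ioc (0:ℝ) 1) {s t : ℝ} (hs : 0 ≤ s) (ht : 0 ≤ t) :
    Rbif H K t t - Rbif H K t s - Rbif H K s t + Rbif H K s s ≤ 2 * |t - s| ^ (2 * (H * K)) := by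
  obtain ⟨h0, h1⟩ := hH
  obtain ⟨k0, k1⟩ := hK
  have hhk : 0 < 2 * H * K := by positivity
  unfold Rbif
  rw [abs_sub_comm s t, add_comm (s ^ (2*H)) (t ^ (2*H)), sub_self, sub_self, abs_zero, Real.zero_rpow hhk.ne',
    ← mul_assoc 2 H K]
  set x := t ^ (2 * H)
  set y := s ^ (2 * H)
  have hx : 0 ≤ x := by positivity
  have hy : 0 ≤ y := by positivity
  set d := |t - s| ^ (2 * H * K)
  have hd : 0 ≤ d := by positivity
  have hc := (Real.concaveOn_rpow k0.le k1).2 (show 2 * x ∈ Set.Ici (0:ℝ) by simp; exact hx)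
    (show 2 * y ∈ Set.Ici (0:ℝ) by simp; exact hy)
    (show (0:ℝ) ≤ 1 / 2 by norm_num) (show (0:ℝ) ≤ 1 / 2 by norm_num) (by norm_num)
  simp only [smul_eq_mul] at hc
  have e : 1 / 2 * (2 * x) + 1 / 2 * (2 * y) = x + y := by ring
  rw [e] at hc
  have h2 : (2:ℝ) ^ (-K) ≤ 1 := Real.rpow_le_one_of_one_le_of_nonpos (by norm_num) (by linarith)
  have h3 : 0 < (2:ℝ) ^ (-K) := by positivity
  rw [← two_mul x, ← two_mul y]
  nlinarith [mul_nonneg h3.le (sub_nonneg.2 hc), mul_nonneg hd (sub_nonneg.2 h2)]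
end process

end Part4

section Part5
open scoped ENNReal NNReal Pointwise
open Filter Topology

lemma chaining {α : ℝ} (hα : 0 < α) : ∃ C : ℝ, 0 < C ∧ ∀ y : ℝ → ℝ, ContinuousOn y (Set.Icc 0 1) →
    ∀ b : ℝ, 0 ≤ b → (∀ k j : ℕ, j < 2 ^ k →
      |y (((j:ℝ) + 1) / 2 ^ k) - y ((j:ℝ) / 2 ^ k)| ≤ b * ((2:ℝ) ^ (-α)) ^ k) →
    ∀ s ∈ Set.Icc (0:ℝ) 1, ∀ t ∈ Set.Icc (0:ℝ) 1, |y s - y t| ≤ C * b * |s - t| ^ α := by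
  set q : ℝ := (2:ℝ) ^ (-α) with hq
  have q0 : 0 < q := by positivity
  have q1 : q < 1 := Real.rpow_lt_one_of_one_lt_of_neg (by norm_num) (by linarith)
  refine ⟨(1 + 2 / (1 - q)) * 2 ^ α, by have : 0 < 1 - q := by linarith
                                        positivity, ?_⟩
  intro y hy b hb hinc
  -- approximations
  have fl : ∀ u ∈ Set.Icc (0:ℝ) 1, ∀ k : ℕ, ((⌊2 ^ k * u⌋₊ : ℝ) / 2 ^ k) ∈ Set.Icc (0:ℝ) 1 ∧
      (⌊2 ^ k * u⌋₊ : ℝ) / 2 ^ k ≤ u ∧ u - (1/2) ^ k ≤ (⌊2 ^ k * u⌋₊ : ℝ) / 2 ^ k := by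
    intro u hu k
    have h2 : (0:ℝ) < 2 ^ k := by positivity
    have h3 : (⌊2 ^ k * u⌋₊ : ℝ) ≤ 2 ^ k * u := Nat.floor_le (by have := hu.1; positivity)
    have h4 : 2 ^ k * u < (⌊2 ^ k * u⌋₊ : ℝ) + 1 := Nat.lt_floor_add_one _
    have h5 : (⌊2 ^ k * u⌋₊ : ℝ) / 2 ^ k ≤ u := by rw [div_le_iff₀ h2]; linarith
    refine ⟨⟨by positivity, h5.trans hu.2⟩, h5, ?_⟩
    rw [le_div_iff₀ h2, sub_mul, ← mul_pow]; norm_num; linarith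
  have step : ∀ u ∈ Set.Icc (0:ℝ) 1, ∀ k : ℕ,
      |y ((⌊2 ^ k * u⌋₊ : ℝ) / 2 ^ k) - y u| ≤ b * q ^ k / (1 - q) := by
    intro u hu k
    rw [← Real.dist_eq]
    refine dist_le_of_le_geometric_of_tendsto q b q1 (f := fun k => y ((⌊2 ^ k * u⌋₊ : ℝ) / 2 ^ k)) ?_ ?_ k
    · intro k
      have hk : (2:ℝ) ^ (k+1) * u = 2 * (2 ^ k * u) := by rw [pow_succ]; ring
      have hx : 0 ≤ 2 ^ k * u := by have := hu.1; positivity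
      have hx1 : (2:ℝ) ^ k * u ≤ 2 ^ k := mul_le_of_le_one_right (by positivity) hu.2
      set x := (2:ℝ) ^ k * u
      have h3 : (⌊x⌋₊ : ℝ) ≤ x := Nat.floor_le hx
      have h4 : x < (⌊x⌋₊ : ℝ) + 1 := Nat.lt_floor_add_one _
      rw [hk, dist_comm, Real.dist_eq]
      have hc : ⌊2 * x⌋₊ = 2 * ⌊x⌋₊ ∨ ⌊2 * x⌋₊ = 2 * ⌊x⌋₊ + 1 := by
        have a1 : 2 * ⌊x⌋₊ ≤ ⌊2 * x⌋₊ := by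
          apply Nat.le_floor; push_cast; linarith
        have a2 : ⌊2 * x⌋₊ < 2 * ⌊x⌋₊ + 2 := by
          rw [Nat.floor_lt (by positivity)]; push_cast; linarith
        omega
      have e0 : ((2 * ⌊x⌋₊ : ℕ) : ℝ) / 2 ^ (k+1) = (⌊x⌋₊ : ℝ) / 2 ^ k := by
        push_cast; rw [pow_succ]; field_simp
      rcases hc with hc | hc
      · rw [hc, e0, sub_self, abs_zero]; positivity
      · rw [hc]
        have hlt : 2 * ⌊x⌋₊ < 2 ^ (k+1) := by
          have a3 : 2 * ⌊x⌋₊ + 1 ≤ ⌊2 * x⌋₊ := hc.ge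
          have a4 : ((2 * ⌊x⌋₊ + 1 : ℕ) : ℝ) ≤ 2 * x := (Nat.le_floor_iff (by positivity)).1 a3
          have a5 : ((2 * ⌊x⌋₊ + 1 : ℕ) : ℝ) ≤ ((2 ^ (k+1) : ℕ) : ℝ) := by
            push_cast at a4 ⊢; rw [pow_succ]; linarith
          have := Nat.cast_le.1 a5
          omega
        have := hinc (k+1) _ hlt
        rw [e0] at this
        push_cast at this ⊢
        refine this.trans ?_
        rw [pow_succ]
        gcongr
        exact mul_le_of_le_one_right (by positivity) q1.le
    · have hc := hy u hu
      refine hc.tendsto.comp ?_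
      apply tendsto_nhdsWithin_of_tendsto_nhds_of_eventually_within
      · refine tendsto_of_tendsto_of_tendsto_of_le_of_le (g := fun k : ℕ => u - (1/2:ℝ) ^ k) (h := fun _ => u) ?_ tendsto_const_nhds ?_ ?_
        · have := (tendsto_pow_atTop_nhds_zero_of_lt_one (r := (1/2:ℝ)) (by norm_num) (by norm_num)).const_sub u
          simpa using this
        · intro k; exact (fl u hu k).2.2
        · intro k; exact (fl u hu k).2.1
      · exact Eventually.of_forall fun k => (fl u hu k).1
  have main : ∀ s ∈ Set.Icc (0:ℝ) 1, ∀ t ∈ Set.Icc (0:ℝ) 1, s < t →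
      |y s - y t| ≤ (1 + 2 / (1 - q)) * 2 ^ α * b * |s - t| ^ α := by
    intro s hs t ht hst
    obtain ⟨k, hk1, hk2⟩ := exists_nat_pow_near_of_lt_one (x := t - s) (y := (1/2:ℝ)) (by linarith)
      (by linarith [hs.1, ht.2]) (by norm_num) (by norm_num)
    have m1 : |y ((⌊2 ^ k * t⌋₊ : ℝ) / 2 ^ k) - y ((⌊2 ^ k * s⌋₊ : ℝ) / 2 ^ k)| ≤ b * q ^ k := by
      have hle : 2 ^ k * t ≤ 2 ^ k * s + 1 := by
        have : (2:ℝ) ^ k * (t - s) ≤ 2 ^ k * (1/2) ^ k := by gcongr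
        rw [← mul_pow] at this; norm_num at this; linarith
      have a0 : ⌊2 ^ k * s⌋₊ ≤ ⌊2 ^ k * t⌋₊ := Nat.floor_le_floor (by gcongr)
      have a1 : ⌊2 ^ k * t⌋₊ ≤ ⌊2 ^ k * s⌋₊ + 1 := by
        rw [← Nat.floor_add_one (by have := hs.1; positivity)]
        exact Nat.floor_le_floor hle
      have hc : ⌊2 ^ k * t⌋₊ = ⌊2 ^ k * s⌋₊ ∨ ⌊2 ^ k * t⌋₊ = ⌊2 ^ k * s⌋₊ + 1 := by omega
      rcases hc with hc | hc
      · rw [hc, sub_self, abs_zero]; positivity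
      · rw [hc]
        push_cast
        refine hinc k _ ?_
        have a3 : (⌊2 ^ k * t⌋₊ : ℝ) ≤ 2 ^ k * t := Nat.floor_le (by have := ht.1; positivity)
        have a4 : (2:ℝ) ^ k * t ≤ 2 ^ k := mul_le_of_le_one_right (by positivity) ht.2
        have a5 : ((⌊2 ^ k * s⌋₊ + 1 : ℕ) : ℝ) ≤ ((2 ^ k : ℕ) : ℝ) := by
          rw [← hc]; push_cast; linarith
        have := Nat.cast_le.1 a5
        omega
    have m2 := step s hs k
    have m3 := step t ht k
    have m4 : q ^ k ≤ 2 ^ α * |s - t| ^ α := by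
      rw [abs_sub_comm, abs_of_pos (by linarith : 0 < t - s), ← Real.mul_rpow (by norm_num) (by linarith)]
      have : q ^ k = ((1/2:ℝ) ^ k) ^ α := by
        rw [hq, ← Real.rpow_natCast, ← Real.rpow_mul (by norm_num), ← Real.rpow_natCast, ← Real.rpow_mul (by norm_num),
          one_div, Real.inv_rpow (by norm_num), ← Real.rpow_neg (by norm_num)]
        congr 1; ring
      rw [this]
      apply Real.rpow_le_rpow (by positivity) _ hα.le
      rw [pow_succ] at hk1; linarith
    have tri : |y s - y t| ≤ b * q ^ k + b * q ^ k / (1 - q) + b * q ^ k / (1 - q) := by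
      rw [abs_le] at *
      constructor <;> linarith [m1.1, m1.2, m2.1, m2.2, m3.1, m3.2]
    have h1q : 0 < 1 - q := by linarith
    calc _ ≤ b * q ^ k + b * q ^ k / (1 - q) + b * q ^ k / (1 - q) := tri
      _ = (1 + 2 / (1 - q)) * b * q ^ k := by ring
      _ ≤ (1 + 2 / (1 - q)) * b * (2 ^ α * |s - t| ^ α) := by gcongr
      _ = _ := by ring
  intro s hs t ht
  rcases lt_trichotomy s t with h | h | h
  · exact main s hs t ht h
  · subst h; simp [Real.zero_rpow hα.ne']
  · rw [abs_sub_comm, abs_sub_comm s t]; exact main t ht s hs h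

lemma holderNorm_le {α : ℝ} {y : ℝ → ℝ} {c : ℝ} (hc : 0 ≤ c)
    (h : ∀ s ∈ Set.Icc (0:ℝ) 1, ∀ t ∈ Set.Icc (0:ℝ) 1, |y s - y t| ≤ c * |s - t| ^ α) :
    holderNorm α y ≤ c := by
  apply Real.sSup_le _ hc
  rintro z ⟨s, hs, t, ht, hst, rfl⟩
  have : 0 < |s - t| := abs_pos.2 (sub_ne_zero.2 hst)
  rw [div_le_iff₀ (by positivity)]
  exact h s hs t ht

lemma le_of_holderNorm {α : ℝ} (hα : 0 < α) {y : ℝ → ℝ} {c ε : ℝ}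
    (h : ∀ s ∈ Set.Icc (0:ℝ) 1, ∀ t ∈ Set.Icc (0:ℝ) 1, |y s - y t| ≤ c * |s - t| ^ α)
    (hn : holderNorm α y ≤ ε) :
    ∀ s ∈ Set.Icc (0:ℝ) 1, ∀ t ∈ Set.Icc (0:ℝ) 1, |y s - y t| ≤ ε * |s - t| ^ α := by
  intro s hs t ht
  rcases eq_or_ne s t with rfl | hst
  · simp [Real.zero_rpow hα.ne']
  have h0 : 0 < |s - t| := abs_pos.2 (sub_ne_zero.2 hst)
  rw [← div_le_iff₀ (by positivity)]
  have hbd : BddAbove {z : ℝ | ∃ s ∈ Set.Icc (0:ℝ) 1, ∃ t ∈ Set.Icc (0:ℝ) 1,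
    s ≠ t ∧ z = |y s - y t| / |s - t| ^ α} := by
    refine ⟨c, ?_⟩
    rintro z ⟨s, hs, t, ht, hst, rfl⟩
    have : 0 < |s - t| := abs_pos.2 (sub_ne_zero.2 hst)
    rw [div_le_iff₀ (by positivity)]
    exact h s hs t ht
  exact le_trans (le_csSup hbd ⟨s, hs, t, ht, hst, rfl⟩) hn

end Part5

section Part6
open scoped ENNReal NNReal Pointwise
open Filter Topology

lemma gauss_scale (v : ℝ≥0) {σ r : ℝ} (hr : 0 ≤ r) (hσ : 0 ≤ σ) (hv : (v:ℝ) ≤ σ ^ 2) :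
    gaussianReal 0 1 {x | |x| ≤ r} ≤ gaussianReal 0 v {x | |x| ≤ r * σ} := by
  have h := gaussianReal_map_const_mul (μ := 0) (v := 1) (Real.sqrt v)
  have e : (gaussianReal 0 v) = (gaussianReal 0 1).map (Real.sqrt v * ·) := by
    rw [h]; congr 1
    · simp
    · ext; simp
  rw [e, Measure.map_apply (by fun_prop) (measurableSet_le (by fun_prop) (by fun_prop))]
  apply measure_mono
  intro x hx
  simp only [Set.mem_preimage, Set.mem_ofPred_eq] at *
  rw [abs_mul, abs_of_nonneg (Real.sqrt_nonneg _), mul_comm]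
  have : Real.sqrt v ≤ σ := by rw [Real.sqrt_le_left hσ]; exact hv
  gcongr

lemma rpow_le_exp {p r : ℝ} (hp : 0 < p) (hr : 0 < r) : r ^ p ≤ p ^ p * Real.exp r := by
  have h1 : Real.log (r / p) ≤ r / p := (Real.log_le_sub_one_of_pos (by positivity)).trans (by linarith)
  rw [Real.rpow_def_of_pos hr, Real.rpow_def_of_pos hp, ← Real.exp_add]
  apply Real.exp_le_exp.2
  rw [Real.log_div hr.ne' hp.ne', le_div_iff₀ hp] at h1
  linarith

lemma gauss_tail_std {p : ℝ} (hp : 0 < p) : ∃ C : ℝ, 0 < C ∧ ∀ r : ℝ, 0 < r →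
    (gaussianReal 0 1).real {x | |x| ≤ r}ᶜ ≤ C * r ^ (-p) := by
  refine ⟨2 * Real.exp (1/2) * p ^ p, by positivity, fun r hr => ?_⟩
  have hIntg : ∀ t : ℝ, Integrable (fun x => Real.exp (t * x)) (gaussianReal 0 1) := fun t => integrable_exp_mul_gaussianReal t
  have h1 := measure_ge_le_exp_mul_mgf (μ := gaussianReal 0 1) (X := id) (t := 1) r (by norm_num) (hIntg 1)
  have h2 := measure_le_le_exp_mul_mgf (μ := gaussianReal 0 1) (X := id) (t := -1) (-r) (by norm_num) (hIntg _)
  rw [mgf_id_gaussianReal] at h1 h2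
  simp only [id_eq] at h1 h2
  have h3 : {x : ℝ | |x| ≤ r}ᶜ ⊆ {x | r ≤ x} ∪ {x | x ≤ -r} := by
    intro x hx
    simp only [Set.mem_compl_iff, Set.mem_ofPred_eq, not_le, lt_abs, Set.mem_union] at *
    rcases hx with h | h
    · left; exact h.le
    · right; linarith
  have h4 := (measureReal_mono (μ := gaussianReal 0 1) h3).trans (measureReal_union_le _ _)
  have h5 : Real.exp (-r) ≤ p ^ p * r ^ (-p) := by
    rw [Real.exp_neg, Real.rpow_neg hr.le, ← div_eq_mul_inv, inv_le_iff_one_le_mul₀ (by positivity), div_mul_eq_mul_div,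
      one_le_div (by positivity)]
    exact rpow_le_exp hp hr
  refine h4.trans ((add_le_add h1 h2).trans ?_)
  simp
  nlinarith [Real.exp_pos (2⁻¹ : ℝ)]

lemma gauss_lower_std {p : ℝ} (hp : 0 < p) : ∃ C : ℝ, 0 < C ∧ ∀ r : ℝ, 0 < r →
    Real.exp (-C * r ^ (-p)) ≤ (gaussianReal 0 1).real {x | |x| ≤ r} := by
  obtain ⟨C, hC, ht⟩ := gauss_tail_std hp
  set R := (2 * C) ^ (1 / p) with hR
  have hR0 : 0 < R := by positivity
  set c := 2 * gaussianPDFReal 0 1 R with hc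
  have hc0 : 0 < c := by have := gaussianPDFReal_pos 0 1 R (by simp); positivity
  refine ⟨2 * C + (|Real.log c| * R ^ p + 1 / p), by positivity, fun r hr => ?_⟩
  have hrp : 0 < r ^ (-p) := by positivity
  rcases le_or_gt R r with h | h
  · have h1 := ht r hr
    have hm : MeasurableSet {x : ℝ | |x| ≤ r} := measurableSet_le (by fun_prop) (by fun_prop)
    rw [probReal_compl_eq_one_sub hm] at h1
    have hx : C * r ^ (-p) ≤ 1/2 := by
      have : r ^ (-p) ≤ R ^ (-p) := Real.rpow_le_rpow_of_nonpos hR0 h (by linarith)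
      have e : R ^ (-p) = (2 * C)⁻¹ := by
        rw [hR, ← Real.rpow_mul (by positivity)]
        have : 1 / p * -p = -1 := by field_simp
        rw [this, Real.rpow_neg_one]
      rw [e] at this
      calc _ ≤ C * (2 * C)⁻¹ := by gcongr
        _ = 1/2 := by field_simp
    set x := C * r ^ (-p)
    have hx0 : 0 ≤ x := by positivity
    have h2 : Real.exp (-(2 * x)) ≤ 1 - x := by
      rw [Real.exp_neg, inv_le_iff_one_le_mul₀ (by positivity)]
      have := Real.add_one_le_exp (2 * x)
      nlinarith
    refine le_trans (Real.exp_le_exp.2 ?_) (h2.trans (by linarith))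
    have : 0 ≤ (|Real.log c| * R ^ p + 1 / p) * r ^ (-p) := by positivity
    simp only [x]; nlinarith
  · have h1 : c * r ≤ (gaussianReal 0 1).real {x | |x| ≤ r} := by
      rw [measureReal_def, gaussianReal_apply_eq_integral 0 (by simp), ENNReal.toReal_ofReal
        (integral_nonneg fun x => gaussianPDFReal_nonneg _ _ _)]
      have hs : {x : ℝ | |x| ≤ r} = Set.Icc (-r) r := by ext x; simp [abs_le]
      rw [hs]
      have : ∫ x in Set.Icc (-r) r, gaussianPDFReal 0 1 R ≤ ∫ x in Set.Icc (-r) r, gaussianPDFReal 0 1 x := by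
        apply setIntegral_mono_on _ (integrable_gaussianPDFReal 0 1).integrableOn measurableSet_Icc
        · intro x hx
          simp only [gaussianPDFReal, sub_zero]
          have : x ^ 2 ≤ R ^ 2 := by apply sq_le_sq'; linarith [hx.1]; linarith [hx.2]
          gcongr
        · simp
      simp at this
      rw [max_eq_left (by linarith)] at this
      refine le_trans (le_of_eq ?_) this
      rw [hc]; ring
    refine le_trans ?_ h1
    rw [← Real.log_le_log_iff (by positivity) (by positivity), Real.log_exp, Real.log_mul hc0.ne' hr.ne']
    have h2 := Real.log_le_rpow_div (x := r⁻¹) (by positivity) hp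
    rw [Real.log_inv, Real.inv_rpow hr.le, ← Real.rpow_neg hr.le] at h2
    have h3 : 1 ≤ R ^ p * r ^ (-p) := by
      rw [Real.rpow_neg hr.le, ← div_eq_mul_inv, one_le_div (by positivity)]
      gcongr
    have h4 : -|Real.log c| ≤ Real.log c := neg_abs_le _
    have h5 : |Real.log c| ≤ |Real.log c| * (R ^ p * r ^ (-p)) := le_mul_of_one_le_right (abs_nonneg _) h3
    have h6 : r ^ (-p) / p = 1 / p * r ^ (-p) := by ring
    nlinarith [mul_pos hC hrp]

lemma gauss_lower {p : ℝ} (hp : 0 < p) : ∃ C : ℝ, 0 < C ∧ ∀ r : ℝ, 0 < r → ∀ (v : ℝ≥0) (σ : ℝ), 0 ≤ σ →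
    (v:ℝ) ≤ σ ^ 2 → ENNReal.ofReal (Real.exp (-C * r ^ (-p))) ≤ gaussianReal 0 v {x | |x| ≤ r * σ} := by
  obtain ⟨C, hC, h⟩ := gauss_lower_std hp
  refine ⟨C, hC, fun r hr v σ hσ hv => le_trans ?_ (gauss_scale v hr.le hσ hv)⟩
  rw [← ofReal_measureReal]
  exact ENNReal.ofReal_le_ofReal (h r hr)

lemma gauss_tail {p : ℝ} (hp : 0 < p) : ∃ C : ℝ, 0 < C ∧ ∀ r : ℝ, 0 < r → ∀ (v : ℝ≥0) (σ : ℝ), 0 ≤ σ →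
    (v:ℝ) ≤ σ ^ 2 → gaussianReal 0 v {x | |x| ≤ r * σ}ᶜ ≤ ENNReal.ofReal (C * r ^ (-p)) := by
  obtain ⟨C, hC, h⟩ := gauss_tail_std hp
  refine ⟨C, hC, fun r hr v σ hσ hv => ?_⟩
  have ms : ∀ a : ℝ, MeasurableSet {x : ℝ | |x| ≤ a} := fun a => measurableSet_le (by fun_prop) (by fun_prop)
  have : gaussianReal 0 v {x | |x| ≤ r * σ}ᶜ ≤ gaussianReal 0 1 {x | |x| ≤ r}ᶜ := by
    rw [prob_compl_eq_one_sub (ms _), prob_compl_eq_one_sub (ms _)]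
    exact tsub_le_tsub_left (gauss_scale v hr.le hσ hv) _
  refine this.trans ?_
  rw [← ofReal_measureReal]
  exact ENNReal.ofReal_le_ofReal (h r hr)

end Part6

section Part7
open scoped ENNReal NNReal Pointwise
open Filter Topology

lemma tele_min {s y : ℝ} (hs : s ^ 2 = 2) (hs0 : 1.4 ≤ s) (hs1 : s ≤ 1.5) (hy : 0 < y) :
    min y y⁻¹ ≤ 13 * (s * y / (1 + s * y) - y / (1 + y)) := by
  have e : s * y / (1 + s * y) - y / (1 + y) = (s - 1) * y / ((1 + y) * (1 + s * y)) := by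
    field_simp; ring
  rw [e, ← mul_div_assoc]
  rcases le_total y 1 with h | h
  · refine (min_le_left _ _).trans ?_
    rw [le_div_iff₀ (by positivity)]
    have : (1 + y) * (1 + s * y) ≤ 5 := by
      have : (1 + y) * (1 + s * y) ≤ 2 * 2.5 := by
        apply mul_le_mul (by linarith) (by nlinarith) (by positivity) (by norm_num)
      linarith
    nlinarith
  · refine (min_le_right _ _).trans ?_
    rw [le_div_iff₀ (by positivity), inv_mul_le_iff₀ hy]
    have : (1 + y) * (1 + s * y) ≤ 5 * y ^ 2 := by
      have : (1 + y) * (1 + s * y) ≤ (2 * y) * (2.5 * y) := by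
        apply mul_le_mul (by linarith) (by nlinarith) (by positivity) (by positivity)
      linarith
    nlinarith [sq_nonneg y]

lemma sum_min_le {y0 : ℝ} (hy : 0 < y0) (m : ℕ) :
    ∑ k ∈ Finset.range m, min (Real.sqrt 2 ^ k * y0) (Real.sqrt 2 ^ k * y0)⁻¹ ≤ 13 := by
  have s2 : Real.sqrt 2 ^ 2 = 2 := Real.sq_sqrt (by norm_num)
  have sl : 1.4 ≤ Real.sqrt 2 := by apply Real.le_sqrt_of_sq_le; norm_num
  have su : Real.sqrt 2 ≤ 1.5 := by rw [Real.sqrt_le_left (by norm_num)]; norm_num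
  set s := Real.sqrt 2
  have s0 : 0 < s := by linarith
  have := Finset.sum_range_sub (fun k => 13 * (s ^ k * y0 / (1 + s ^ k * y0))) m
  calc _ ≤ ∑ k ∈ Finset.range m, ((13 * (s ^ (k+1) * y0 / (1 + s ^ (k+1) * y0))) - 13 * (s ^ k * y0 / (1 + s ^ k * y0))) := by
        apply Finset.sum_le_sum
        intro k _
        have := tele_min s2 sl su (y := s ^ k * y0) (by positivity)
        rw [pow_succ', mul_assoc]
        linarith
    _ = _ := this
    _ ≤ 13 := by
        have h1 : s ^ m * y0 / (1 + s ^ m * y0) ≤ 1 := by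
          rw [div_le_one (by positivity)]; linarith
        have h2 : 0 ≤ s ^ 0 * y0 / (1 + s ^ 0 * y0) := by positivity
        linarith

section process
variable {Ω : Type*} [MeasurableSpace Ω] {μ : Measure Ω} [IsProbabilityMeasure μ] {H K : ℝ}
  {B : ℝ → Ω → ℝ}

lemma bif_incr_gauss (hH : H ∈ Set.Ioo (0:ℝ) 1) (hK : K ∈ Set.Ioc (0:ℝ) 1) (hB : IsBifBM μ H K B)
    {s t : ℝ} (hs : 0 ≤ s) (ht : 0 ≤ t) :
    ∃ v : ℝ≥0, (v:ℝ) ≤ (Real.sqrt 2 * |t - s| ^ (H * K)) ^ 2 ∧ ∀ S, MeasurableSet S →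
      μ {ω | B t ω - B s ω ∈ S} = gaussianReal 0 v S := by
  refine ⟨Real.toNNReal (Rbif H K t t - Rbif H K t s - Rbif H K s t + Rbif H K s s), ?_, fun S hS => ?_⟩
  rotate_left
  · rw [← bif_incr_one hB hs ht, Measure.map_apply_of_aemeasurable
      (f := fun ω => B t ω - B s ω) ((bif_aem hB ht).sub (bif_aem hB hs)) hS]
    rfl
  · rw [mul_pow, Real.sq_sqrt (by norm_num), ← Real.rpow_natCast, ← Real.rpow_mul (abs_nonneg _)]
    rw [Real.coe_toNNReal']
    refine max_le ((Rbif_var_le hH hK hs ht).trans (le_of_eq ?_)) (by positivity)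
    congr 2; push_cast; ring

lemma sigma_eq (h : ℝ) (k j : ℕ) :
    Real.sqrt 2 * |((j:ℝ) + 1) / 2 ^ k - (j:ℝ) / 2 ^ k| ^ h = Real.sqrt 2 * ((2:ℝ) ^ (-h)) ^ k := by
  have : ((j:ℝ) + 1) / 2 ^ k - (j:ℝ) / 2 ^ k = ((2:ℝ) ^ k)⁻¹ := by ring
  rw [this, abs_of_pos (by positivity), Real.inv_rpow (by positivity), ← Real.rpow_neg (by positivity),
    ← Real.rpow_natCast, ← Real.rpow_natCast, ← Real.rpow_mul (by norm_num), ← Real.rpow_mul (by norm_num), mul_comm (k:ℝ)]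

lemma thr_eq {h α b : ℝ} (k : ℕ) :
    b * ((2:ℝ) ^ (-α)) ^ k = (b / Real.sqrt 2 * ((2:ℝ) ^ (h - α)) ^ k) * (Real.sqrt 2 * ((2:ℝ) ^ (-h)) ^ k) := by
  have : (2:ℝ) ^ (-α) = (2:ℝ) ^ (h - α) * (2:ℝ) ^ (-h) := by
    rw [← Real.rpow_add (by norm_num)]; congr 1; ring
  rw [this, mul_pow]
  have : Real.sqrt 2 ≠ 0 := by positivity
  field_simp

lemma bif_as_holder (hH : H ∈ Set.Ioo (0:ℝ) 1) (hK : K ∈ Set.Ioc (0:ℝ) 1) (hB : IsBifBM μ H K B)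
    {α : ℝ} (hα : α ∈ Set.Ioo 0 (H * K)) :
    ∀ᵐ ω ∂μ, ∃ c, ∀ s ∈ Set.Icc (0:ℝ) 1, ∀ t ∈ Set.Icc (0:ℝ) 1, |B s ω - B t ω| ≤ c * |s - t| ^ α := by
  obtain ⟨C, hC, hch⟩ := chaining hα.1
  set q : ℝ := (2:ℝ) ^ (-α) with hq
  have q0 : 0 < q := by positivity
  set β := H * K - α with hβ
  have β0 : 0 < β := by linarith [hα.2]
  obtain ⟨D, hD, htl⟩ := gauss_tail (p := 2 / β) (by positivity)
  have hsum : ∑' i : (Σ k : ℕ, Fin (2 ^ k)), μ {ω | |B (((i.2:ℝ) + 1) / 2 ^ i.1) ω - B ((i.2:ℝ) / 2 ^ i.1) ω| ≤ 1 * q ^ i.1}ᶜ ≠ ∞ := by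
    rw [ENNReal.tsum_sigma']
    have hb : ∀ k : ℕ, ∑' j : Fin (2 ^ k), μ {ω | |B (((j:ℝ) + 1) / 2 ^ k) ω - B ((j:ℝ) / 2 ^ k) ω| ≤ 1 * q ^ k}ᶜ
        ≤ ENNReal.ofReal (D * (Real.sqrt 2) ^ (2 / β) * (1/2) ^ k) := by
      intro k
      rw [tsum_fintype]
      have : ∀ j : Fin (2 ^ k), μ {ω | |B (((j:ℝ) + 1) / 2 ^ k) ω - B ((j:ℝ) / 2 ^ k) ω| ≤ 1 * q ^ k}ᶜ ≤
          ENNReal.ofReal (D * (Real.sqrt 2) ^ (2 / β) * (1/4) ^ k) := by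
        intro j
        obtain ⟨v, hv, hS⟩ := bif_incr_gauss hH hK hB (s := (j:ℝ) / 2 ^ k) (t := ((j:ℝ) + 1) / 2 ^ k) (by positivity) (by positivity)
        rw [sigma_eq] at hv
        have := htl (1 / Real.sqrt 2 * ((2:ℝ) ^ β) ^ k) (by positivity) v _ (by positivity) hv
        rw [← thr_eq, ← hS _ (measurableSet_le (by fun_prop) (by fun_prop)).compl] at this
        refine le_trans this (ENNReal.ofReal_le_ofReal (le_of_eq ?_))
        rw [mul_assoc]
        congr 1
        rw [Real.mul_rpow (by positivity) (by positivity), one_div, Real.inv_rpow (by positivity),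
          ← Real.rpow_neg (by positivity), neg_neg, ← Real.rpow_natCast, ← Real.rpow_mul (by positivity),
          ← Real.rpow_mul (by norm_num)]
        congr 1
        have : β * (k * -(2 / β)) = -2 * k := by field_simp
        rw [this, Real.rpow_mul (by norm_num), Real.rpow_natCast]
        congr 1
        rw [Real.rpow_neg (by norm_num)]; norm_num
      refine (Finset.sum_le_sum fun j _ => this j).trans (le_of_eq ?_)
      rw [Finset.sum_const, nsmul_eq_mul, Finset.card_univ, Fintype.card_fin, ← ENNReal.ofReal_natCast,
        ← ENNReal.ofReal_mul (by positivity)]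
      congr 1
      push_cast
      have : (1/2:ℝ) ^ k = 2 ^ k * (1/4) ^ k := by rw [← mul_pow]; norm_num
      rw [this]; ring
    refine ne_top_of_le_ne_top ?_ (ENNReal.tsum_le_tsum hb)
    rw [← ENNReal.ofReal_tsum_of_nonneg (fun k => by positivity)
      ((summable_geometric_of_lt_one (by norm_num) (by norm_num)).mul_left _)]
    exact ENNReal.ofReal_ne_top
  filter_upwards [ae_finite_setOfPred_mem hsum, hB.1] with ω hω hcont
  obtain ⟨M, hM⟩ := (hω.image (fun i : (Σ k : ℕ, Fin (2 ^ k)) =>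
    |B (((i.2:ℝ) + 1) / 2 ^ i.1) ω - B ((i.2:ℝ) / 2 ^ i.1) ω| / q ^ i.1)).bddAbove
  refine ⟨C * max M 1, hch _ (hcont.mono Set.Icc_subset_Ici_self) _ (by positivity) ?_⟩
  intro k j hj
  by_cases h : |B (((j:ℝ) + 1) / 2 ^ k) ω - B ((j:ℝ) / 2 ^ k) ω| ≤ 1 * q ^ k
  · refine h.trans ?_
    gcongr
    exact le_max_right _ _
  · have := hM (Set.mem_image_of_mem _ (show (⟨k, ⟨j, hj⟩⟩ : Σ k : ℕ, Fin (2 ^ k)) ∈ _ from h))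
    simp only at this
    rw [div_le_iff₀ (by positivity)] at this
    refine this.trans ?_
    gcongr
    exact le_max_left _ _

lemma bif_lower (hH : H ∈ Set.Ioo (0:ℝ) 1) (hK : K ∈ Set.Ioc (0:ℝ) 1) (hB : IsBifBM μ H K B)
    {α : ℝ} (hα : α ∈ Set.Ioo 0 (H * K)) :
    ∃ c : ℝ, 0 < c ∧ ∀ ε : ℝ, 0 < ε → 
      ENNReal.ofReal (Real.exp (-c * ε ^ (-(1 / (H * K - α))))) ≤
          μ {ω | holderNorm α (fun t => B t ω) ≤ ε} := by
  obtain ⟨C, hC, hch⟩ := chaining hα.1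
  set q : ℝ := (2:ℝ) ^ (-α) with hq
  have q0 : 0 < q := by positivity
  set β := H * K - α with hβ
  have β0 : 0 < β := by linarith [hα.2]
  obtain ⟨D1, hD1, hl1⟩ := gauss_lower (p := 1 / (2 * β)) (by positivity)
  obtain ⟨D2, hD2, hl2⟩ := gauss_lower (p := 3 / (2 * β)) (by positivity)
  set c' : ℝ := C⁻¹ / Real.sqrt 2 with hc'
  have hc0 : 0 < c' := by positivity
  set D := max (D1 * c' ^ (-(1 / (2 * β)))) (D2 * c' ^ (-(3 / (2 * β)))) with hD
  have hD0 : 0 < D := lt_max_of_lt_left (by positivity)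
  refine ⟨13 * D, by positivity, fun ε hε => ?_⟩
  set N := ε ^ (-(1 / β)) with hN
  have hN0 : 0 < N := by positivity
  set y0 := ε ^ (1 / (2 * β)) with hy0
  have hy00 : 0 < y0 := by positivity
  set y : ℕ → ℝ := fun k => Real.sqrt 2 ^ k * y0 with hy
  have ypos : ∀ k, 0 < y k := fun k => by simp only [hy]; positivity
  have hNy : ∀ k, N * (y k) ^ 2 = 2 ^ k := by
    intro k
    simp only [hy]
    rw [mul_pow, ← pow_mul, mul_comm k 2, pow_mul, Real.sq_sqrt (by norm_num)]
    have : N * y0 ^ 2 = 1 := by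
      rw [hN, hy0, ← Real.rpow_natCast, ← Real.rpow_mul hε.le, ← Real.rpow_add hε]
      rw [show -(1 / β) + 1 / (2 * β) * ((2:ℕ):ℝ) = 0 by push_cast; field_simp; ring, Real.rpow_zero]
    rw [mul_left_comm, this, mul_one]
  have hyb : ∀ k, (y k) ^ (2 * β) = ε * ((2:ℝ) ^ β) ^ k := by
    intro k
    simp only [hy]
    rw [Real.mul_rpow (by positivity) (by positivity), hy0, ← Real.rpow_mul hε.le,
      show 1 / (2 * β) * (2 * β) = 1 by field_simp, Real.rpow_one, mul_comm]
    congr 1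
    rw [Real.sqrt_eq_rpow, ← Real.rpow_natCast, ← Real.rpow_natCast, ← Real.rpow_mul (by positivity),
      ← Real.rpow_mul (by positivity), ← Real.rpow_mul (by positivity)]
    congr 1; ring
  -- single increments
  set b := ε / C with hb
  have hb0 : 0 < b := by positivity
  set A : ℕ → ℕ → Set Ω := fun k j => {ω | |B (((j:ℝ) + 1) / 2 ^ k) ω - B ((j:ℝ) / 2 ^ k) ω| ≤ b * q ^ k} with hA
  have hone : ∀ k j : ℕ, ENNReal.ofReal (Real.exp (-(D * N * min (y k) (y k)⁻¹ / 2 ^ k))) ≤ μ (A k j) := by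
    intro k j
    obtain ⟨v, hv, hS⟩ := bif_incr_gauss hH hK hB (s := (j:ℝ) / 2 ^ k) (t := ((j:ℝ) + 1) / 2 ^ k) (by positivity) (by positivity)
    rw [sigma_eq] at hv
    have hr : b / Real.sqrt 2 * ((2:ℝ) ^ β) ^ k = c' * (y k) ^ (2 * β) := by
      rw [hyb, hb, hc']; ring
    have hset : μ (A k j) = gaussianReal 0 v {x | |x| ≤ (b / Real.sqrt 2 * ((2:ℝ) ^ β) ^ k) * (Real.sqrt 2 * ((2:ℝ) ^ (-(H * K))) ^ k)} := by
      rw [← thr_eq, ← hS _ (measurableSet_le (by fun_prop) (by fun_prop))]; rfl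
    have h1 := hl1 (b / Real.sqrt 2 * ((2:ℝ) ^ β) ^ k) (by positivity) v _ (by positivity) hv
    have h2 := hl2 (b / Real.sqrt 2 * ((2:ℝ) ^ β) ^ k) (by positivity) v _ (by positivity) hv
    rw [← hset, hr, Real.mul_rpow hc0.le (by have := ypos k; positivity), ← Real.rpow_mul (ypos k).le] at h1 h2
    rw [show 2 * β * -(1 / (2 * β)) = -1 by field_simp, Real.rpow_neg_one] at h1
    rw [show 2 * β * -(3 / (2 * β)) = ((-3 : ℤ):ℝ) by push_cast; field_simp, Real.rpow_intCast] at h2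
    have yk := ypos k
    rw [← hNy k]
    rcases min_choice (y k) (y k)⁻¹ with hm | hm
    · rw [hm]
      refine le_trans (ENNReal.ofReal_le_ofReal (Real.exp_le_exp.2 ?_)) h1
      rw [show D * N * y k / (N * y k ^ 2) = D * (y k)⁻¹ by field_simp]
      have : D1 * c' ^ (-(1 / (2 * β))) * (y k)⁻¹ ≤ D * (y k)⁻¹ := by gcongr; exact le_max_left _ _
      linarith
    · rw [hm]
      refine le_trans (ENNReal.ofReal_le_ofReal (Real.exp_le_exp.2 ?_)) h2
      rw [show D * N * (y k)⁻¹ / (N * y k ^ 2) = D * (y k) ^ (-3 : ℤ) by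
        rw [zpow_neg]; field_simp]
      have : D2 * c' ^ (-(3 / (2 * β))) * (y k) ^ (-3 : ℤ) ≤ D * (y k) ^ (-3 : ℤ) := by gcongr; exact le_max_right _ _
      linarith
  set E : ℕ → Set Ω := fun m => {ω | ∀ i : (Σ k : Fin m, Fin (2 ^ (k:ℕ))), ω ∈ A i.1 i.2} with hE
  have hEm : ∀ m, ENNReal.ofReal (Real.exp (-(13 * D) * N)) ≤ μ (E m) := by
    intro m
    have := sidak μ (ι := (Σ k : Fin m, Fin (2 ^ (k:ℕ))))
      (fun i ω => B (((i.2:ℝ) + 1) / 2 ^ (i.1:ℕ)) ω - B ((i.2:ℝ) / 2 ^ (i.1:ℕ)) ω)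
      (fun i => (bif_aem hB (by positivity)).sub (bif_aem hB (by positivity)))
      (fun a => bif_incr_map hB _ _ (fun i => by positivity) (fun i => by positivity) a)
      (fun i => b * q ^ (i.1:ℕ))
    refine le_trans ?_ this
    refine le_trans ?_ (Finset.prod_le_prod' fun i _ => hone i.1 i.2)
    rw [← ENNReal.ofReal_prod_of_nonneg (fun i _ => (Real.exp_pos _).le), ← Real.exp_sum]
    apply ENNReal.ofReal_le_ofReal
    apply Real.exp_le_exp.2
    rw [Fintype.sum_sigma]
    simp only [Finset.sum_const, Finset.card_univ, Fintype.card_fin, nsmul_eq_mul]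
    rw [Fin.sum_univ_eq_sum_range (fun k => ((2 ^ k : ℕ):ℝ) * -(D * N * min (y k) (y k)⁻¹ / 2 ^ k))]
    have h13 := sum_min_le hy00 m
    calc -(13 * D) * N = -(D * N) * 13 := by ring
      _ ≤ -(D * N) * ∑ k ∈ Finset.range m, min (y k) (y k)⁻¹ := by
        apply mul_le_mul_of_nonpos_left h13; have : 0 < D * N := by positivity
        linarith
      _ = _ := by
        rw [Finset.mul_sum]
        refine Finset.sum_congr rfl fun k _ => ?_
        push_cast; field_simp
  have hAm : ∀ k j, NullMeasurableSet (A k j) μ := fun k j =>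
    nullMeasurableSet_le (((bif_aem hB (by positivity)).sub (bif_aem hB (by positivity))).norm) (by fun_prop)
  have hlim := tendsto_measure_iInter_atTop (μ := μ) (s := E) (fun m => by
    have : E m = ⋂ i : (Σ k : Fin m, Fin (2 ^ (k:ℕ))), A i.1 i.2 := by
      ext ω; simp [hE]
    rw [this]
    exact NullMeasurableSet.iInter fun i => hAm _ _) (by
    intro m m' hmm ω hω i
    exact hω ⟨⟨i.1, i.1.2.trans_le hmm⟩, i.2⟩) ⟨0, measure_ne_top _ _⟩
  refine le_trans (ge_of_tendsto hlim (Eventually.of_forall hEm)) ?_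
  apply measure_mono_ae
  filter_upwards [hB.1] with ω hcont hω
  have hω' : ω ∈ ⋂ n, E n := hω
  have := hch (fun t => B t ω) (hcont.mono Set.Icc_subset_Ici_self) b hb0.le (by
    intro k j hj
    exact Set.mem_iInter.1 hω' (k+1) ⟨⟨k, by omega⟩, ⟨j, hj⟩⟩)
  refine holderNorm_le hε.le ?_
  rw [hb, mul_div_cancel₀ _ hC.ne'] at this
  exact this
end process

end Part7

section Part8
open scoped ENNReal NNReal Pointwise
open Filter Topology

lemma gauss_1d {l : ℝ} {w : ℝ≥0} (hl : 0 < l) (hw : w ≠ 0) :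
    ∫ z, Real.exp (-(l * z ^ 2 / 2)) ∂(gaussianReal 0 w) ≤ 1 / Real.sqrt (w * l) := by
  rw [integral_gaussianReal_eq_integral_smul hw]
  have hw0 : 0 < (w:ℝ) := by positivity
  have hIntg : Integrable (fun z : ℝ => Real.exp (-(l/2) * z ^ 2)) := integrable_exp_neg_mul_sq (by positivity)
  calc _ ≤ ∫ z, (Real.sqrt (2 * Real.pi * w))⁻¹ * Real.exp (-(l/2) * z ^ 2) := by
        apply integral_mono_of_nonneg
        · exact Eventually.of_forall fun z => mul_nonneg (gaussianPDFReal_nonneg _ _ _) (Real.exp_pos _).le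
        · exact hIntg.const_mul _
        · refine Eventually.of_forall fun z => ?_
          simp only [smul_eq_mul, gaussianPDFReal]
          rw [show -(l * z ^ 2 / 2) = -(l/2) * z ^ 2 by ring]
          gcongr
          apply mul_le_of_le_one_right (by positivity)
          apply Real.exp_le_one_iff.2
          rw [neg_div]
          have : 0 ≤ (z - 0) ^ 2 / (2 * (w:ℝ)) := by positivity
          linarith
    _ = _ := by
        rw [integral_const_mul, integral_gaussian, ← Real.sqrt_inv, ← Real.sqrt_mul (by positivity), one_div, ← Real.sqrt_inv]
        congr 1
        field_simp

lemma gauss_box_aux {ι : Type*} [Fintype ι] (ν : Measure (ι → ℝ)) [IsProbabilityMeasure ν] (Q : (ι → ℝ) → ℝ)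
    (hg : ∀ a, ν.map (fun x => ∑ i, a i * x i) = gaussianReal 0 (Real.toNNReal (Q a)))
    {l η : ℝ} (hl : 0 < l) (hη : 0 < η) (hQ : ∀ a, l * ∑ i, a i ^ 2 ≤ Q a) :
    ν.real {x | ∀ i, |x i| ≤ η} ≤ (Real.exp (1/2) * (η / Real.sqrt l)) ^ (Fintype.card ι) := by
  set w : ℝ≥0 := Real.toNNReal (1 / η ^ 2) with hw
  have hw' : (w:ℝ) = 1 / η ^ 2 := Real.coe_toNNReal _ (by positivity)
  have hw0 : w ≠ 0 := by rw [hw]; simp; positivity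
  set γ := gaussianReal 0 w
  set π := Measure.pi (fun _ : ι => γ)
  set f : (ι → ℝ) → (ι → ℝ) → ℂ := fun x z => Complex.exp (((∑ i, z i * x i : ℝ) : ℂ) * Complex.I) with hf
  have hfi : Integrable (Function.uncurry f) (ν.prod π) := by
    refine Integrable.of_bound (C := 1) ?_ ?_
    · apply Measurable.aestronglyMeasurable
      simp only [hf, Function.uncurry_def]
      fun_prop
    · refine Eventually.of_forall fun p => ?_
      simp only [hf, Function.uncurry_def, Complex.norm_exp_ofReal_mul_I, le_refl]
  have A : ∀ x, ∫ z, f x z ∂π = ((∏ i, Real.exp (-(x i ^ 2 / (2 * η ^ 2))) : ℝ) : ℂ) := by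
    intro x
    have : ∀ z, f x z = ∏ i, Complex.exp ((x i : ℂ) * z i * Complex.I) := by
      intro z
      rw [← Complex.exp_sum, ← Finset.sum_mul]
      simp only [hf]; push_cast
      congr 2
      exact Finset.sum_congr rfl fun i _ => mul_comm _ _
    simp only [this]
    rw [integral_fintype_prod_eq_prod (fun i (z:ℝ) => Complex.exp ((x i : ℂ) * z * Complex.I))]
    push_cast
    refine Finset.prod_congr rfl fun i _ => ?_
    rw [← charFun_apply_real, charFun_gaussianReal]
    have : (w:ℂ) = 1 / (η:ℂ) ^ 2 := by
      have := congrArg (fun r : ℝ => (r:ℂ)) hw'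
      push_cast at this; exact this
    simp [this]
    congr 1
    ring
  have Bq : ∀ z, ∫ x, f x z ∂ν = ((Real.exp (-(max (Q z) 0 / 2)) : ℝ) : ℂ) := by
    intro z
    have h1 : charFun (ν.map (fun x => ∑ i, z i * x i)) 1 = ∫ x, f x z ∂ν := by
      rw [charFun_apply_real, integral_map (Measurable.aemeasurable (by fun_prop)) (by fun_prop)]
      simp [hf]
    rw [← h1, hg, charFun_gaussianReal]
    simp only [Complex.ofReal_exp]
    congr 1
    simp [Real.coe_toNNReal']
  have key : ∫ x, (∏ i, Real.exp (-(x i ^ 2 / (2 * η ^ 2)))) ∂ν = ∫ z, Real.exp (-(max (Q z) 0 / 2)) ∂π := by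
    have := integral_integral_swap hfi
    simp only [A, Bq] at this
    rw [integral_complex_ofReal, integral_complex_ofReal] at this
    exact_mod_cast this
  have key2 : ∫ z, Real.exp (-(max (Q z) 0 / 2)) ∂π ≤ (η / Real.sqrt l) ^ (Fintype.card ι) := by
    have hIntg : Integrable (fun z : ι → ℝ => ∏ i, Real.exp (-(l * z i ^ 2 / 2))) π := by
      refine Integrable.of_bound (C := 1) (by apply Measurable.aestronglyMeasurable; fun_prop) ?_
      refine Eventually.of_forall fun z => ?_
      rw [Real.norm_eq_abs, abs_of_nonneg (by positivity)]
      apply Finset.prod_le_one (fun i _ => (Real.exp_pos _).le)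
      intro i _
      apply Real.exp_le_one_iff.2
      have : 0 ≤ l * z i ^ 2 / 2 := by positivity
      linarith
    calc _ ≤ ∫ z, ∏ i, Real.exp (-(l * z i ^ 2 / 2)) ∂π := by
          apply integral_mono_of_nonneg
          · exact Eventually.of_forall fun z => (Real.exp_pos _).le
          · exact hIntg
          · refine Eventually.of_forall fun z => ?_
            simp only
            rw [← Real.exp_sum]
            apply Real.exp_le_exp.2
            rw [Finset.sum_neg_distrib, ← Finset.sum_div, ← Finset.mul_sum]
            have := (hQ z).trans (le_max_left _ 0)
            linarith
      _ = ∏ i : ι, ∫ z, Real.exp (-(l * z ^ 2 / 2)) ∂γ :=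
          integral_fintype_prod_eq_prod (fun _ (z:ℝ) => Real.exp (-(l * z ^ 2 / 2)))
      _ ≤ ∏ i : ι, (η / Real.sqrt l) := by
          apply Finset.prod_le_prod
          · intro i _; exact integral_nonneg fun z => (Real.exp_pos _).le
          · intro i _
            refine (gauss_1d hl hw0).trans (le_of_eq ?_)
            rw [hw', Real.sqrt_mul (by positivity), Real.sqrt_div (by positivity), Real.sqrt_one, Real.sqrt_sq hη.le]
            field_simp
      _ = _ := by rw [Finset.prod_const, Finset.card_univ]
  have hnn : 0 ≤ᵐ[ν] fun x : ι → ℝ => ∏ i, Real.exp (-(x i ^ 2 / (2 * η ^ 2))) :=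
    Eventually.of_forall fun x => by simp only [Pi.zero_apply]; positivity
  have hIntgb : Integrable (fun x : ι → ℝ => ∏ i, Real.exp (-(x i ^ 2 / (2 * η ^ 2)))) ν := by
    refine Integrable.of_bound (C := 1) (by apply Measurable.aestronglyMeasurable; fun_prop) ?_
    refine Eventually.of_forall fun z => ?_
    rw [Real.norm_eq_abs, abs_of_nonneg (by positivity)]
    apply Finset.prod_le_one (fun i _ => (Real.exp_pos _).le)
    intro i _
    apply Real.exp_le_one_iff.2
    have : 0 ≤ z i ^ 2 / (2 * η ^ 2) := by positivity
    linarith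
  have mk := mul_meas_ge_le_integral_of_nonneg hnn hIntgb (Real.exp (-(1/2)) ^ (Fintype.card ι))
  rw [key] at mk
  have hsub : ν.real {x | ∀ i, |x i| ≤ η} ≤ ν.real {x | Real.exp (-(1/2)) ^ (Fintype.card ι) ≤ ∏ i, Real.exp (-(x i ^ 2 / (2 * η ^ 2)))} := by
    refine measureReal_mono ?_ (measure_ne_top _ _)
    intro x hx
    simp only [Set.mem_ofPred_eq] at *
    rw [← Finset.card_univ, ← Finset.prod_const]
    apply Finset.prod_le_prod (fun i _ => (Real.exp_pos _).le)
    intro i _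
    apply Real.exp_le_exp.2
    have : x i ^ 2 ≤ η ^ 2 := by rw [← sq_abs]; have := hx i; gcongr
    have : x i ^ 2 / (2 * η ^ 2) ≤ 1/2 := by rw [div_le_iff₀ (by positivity)]; linarith
    linarith
  have e : Real.exp (1/2) ^ (Fintype.card ι) * Real.exp (-(1/2)) ^ (Fintype.card ι) = 1 := by
    rw [← mul_pow, ← Real.exp_add]; simp
  have mk2 := mk.trans key2
  calc _ ≤ _ := hsub
    _ = Real.exp (1/2) ^ (Fintype.card ι) * (Real.exp (-(1/2)) ^ (Fintype.card ι) * _) := by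
      rw [← mul_assoc, e, one_mul]
    _ ≤ Real.exp (1/2) ^ (Fintype.card ι) * (η / Real.sqrt l) ^ (Fintype.card ι) := by gcongr
    _ = _ := by rw [mul_pow]

lemma gauss_box {Ω : Type*} [MeasurableSpace Ω] (μ : Measure Ω) [IsProbabilityMeasure μ] {ι : Type*} [Fintype ι]
    (X : ι → Ω → ℝ) (hX : ∀ i, AEMeasurable (X i) μ) (Q : (ι → ℝ) → ℝ)
    (hg : ∀ a : ι → ℝ, μ.map (fun ω => ∑ i, a i * X i ω) = gaussianReal 0 (Real.toNNReal (Q a)))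
    {l η : ℝ} (hl : 0 < l) (hη : 0 < η) (hQ : ∀ a, l * ∑ i, a i ^ 2 ≤ Q a) :
    μ {ω | ∀ i, |X i ω| ≤ η} ≤ ENNReal.ofReal ((Real.exp (1/2) * (η / Real.sqrt l)) ^ (Fintype.card ι)) := by
  have hm : AEMeasurable (fun ω i => X i ω) μ := aemeasurable_pi_lambda _ hX
  have := Measure.isProbabilityMeasure_map hm
  have h1 := gauss_box_aux (μ.map (fun ω i => X i ω)) Q (fun a => by
    rw [← hg a, AEMeasurable.map_map_of_aemeasurable (Measurable.aemeasurable (by fun_prop)) hm]; rfl) hl hη hQ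
  have ms : MeasurableSet {x : ι → ℝ | ∀ i, |x i| ≤ η} := by
    have : {x : ι → ℝ | ∀ i, |x i| ≤ η} = ⋂ i, {x | |x i| ≤ η} := by ext; simp
    rw [this]; exact MeasurableSet.iInter fun i => measurableSet_le (by fun_prop) (by fun_prop)
  have h2 : μ {ω | ∀ i, |X i ω| ≤ η} = μ.map (fun ω i => X i ω) {x | ∀ i, |x i| ≤ η} := by
    rw [Measure.map_apply_of_aemeasurable hm ms]; rfl
  rw [h2, ← ofReal_measureReal]
  exact ENNReal.ofReal_le_ofReal h1

end Part8

section Part9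
open scoped ENNReal NNReal Pointwise
open Filter Topology

lemma second_diff {f f' f'' : ℝ → ℝ} {x δ C : ℝ} (hδ : 0 ≤ δ)
    (h1 : ∀ u ∈ Set.Icc (x - δ) (x + δ), HasDerivAt f (f' u) u)
    (h2 : ∀ u ∈ Set.Icc (x - δ) (x + δ), HasDerivAt f' (f'' u) u)
    (hC : ∀ u ∈ Set.Icc (x - δ) (x + δ), |f'' u| ≤ C) :
    |f (x + δ) - 2 * f x + f (x - δ)| ≤ 2 * C * δ ^ 2 := by
  have hC0 : 0 ≤ C := (abs_nonneg _).trans (hC x ⟨by linarith, by linarith⟩)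
  have hd : ∀ u ∈ Set.Icc 0 δ, |f' (x + u) - f' (x - u)| ≤ 2 * C * δ := by
    intro u hu
    have := Convex.norm_image_sub_le_of_norm_hasDerivWithin_le (f := f') (f' := f'') (s := Set.Icc (x - δ) (x + δ)) (C := C)
      (x := x - u) (y := x + u)
      (fun v hv => (h2 v hv).hasDerivWithinAt) (fun v hv => by rw [Real.norm_eq_abs]; exact hC v hv) (convex_Icc _ _)
      ⟨by linarith [hu.2], by linarith [hu.1]⟩ ⟨by linarith [hu.1], by linarith [hu.2]⟩
    rw [Real.norm_eq_abs, Real.norm_eq_abs] at this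
    refine this.trans ?_
    rw [show x + u - (x - u) = 2 * u by ring, abs_of_nonneg (by linarith [hu.1])]
    nlinarith [hu.1, hu.2]
  have := Convex.norm_image_sub_le_of_norm_hasDerivWithin_le (f := fun u => f (x + u) + f (x - u))
    (f' := fun u => f' (x + u) - f' (x - u)) (s := Set.Icc 0 δ) (C := 2 * C * δ) (x := 0) (y := δ) (fun u hu => by
      have a1 : HasDerivAt (fun u => f (x + u)) (f' (x + u)) u :=
        (h1 (x + u) ⟨by linarith [hu.1], by linarith [hu.2]⟩).comp_const_add x u
      have a2 : HasDerivAt (fun u => f (x - u)) (-f' (x - u)) u :=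
        (h1 (x - u) ⟨by linarith [hu.2], by linarith [hu.1]⟩).comp_const_sub x u
      have := a1.add a2
      rw [← sub_eq_add_neg] at this
      exact this.hasDerivWithinAt)
    (fun u hu => by rw [Real.norm_eq_abs]; exact hd u hu) (convex_Icc _ _) ⟨le_rfl, hδ⟩ ⟨hδ, le_rfl⟩
  simp only [Real.norm_eq_abs, add_zero, sub_zero, abs_of_nonneg hδ] at this
  calc _ = |f (x + δ) + f (x - δ) - (f x + f x)| := by congr 1; ring
    _ ≤ _ := this
    _ = _ := by ring

lemma dS1 {p r y s : ℝ} (hs : 0 < s) (hy : 0 ≤ y) :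
    HasDerivAt (fun s => (s ^ p + y) ^ r) (r * p * (s ^ (p - 1) * (s ^ p + y) ^ (r - 1))) s := by
  have hS : 0 < s ^ p + y := by positivity
  have := ((Real.hasDerivAt_rpow_const (p := p) (Or.inl hs.ne')).add_const y).rpow_const (p := r) (Or.inl hS.ne')
  convert this using 1
  ring

lemma dS2 {p r y s : ℝ} (hs : 0 < s) (hy : 0 ≤ y) :
    HasDerivAt (fun s => r * p * (s ^ (p - 1) * (s ^ p + y) ^ (r - 1)))
      (r * p * (p - 1) * s ^ (p - 2) * (s ^ p + y) ^ (r - 1) +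
        r * (r - 1) * p ^ 2 * s ^ (2 * p - 2) * (s ^ p + y) ^ (r - 2)) s := by
  have h1 := Real.hasDerivAt_rpow_const (x := s) (p := p - 1) (Or.inl hs.ne')
  have h2 := dS1 (p := p) (r := r - 1) hs hy
  have := (h1.mul h2).const_mul (r * p)
  refine this.congr_deriv ?_
  have e1 : p - 1 - 1 = p - 2 := by ring
  have e2 : r - 1 - 1 = r - 2 := by ring
  have e3 : s ^ (2 * p - 2) = s ^ (p - 1) * s ^ (p - 1) := by
    rw [← Real.rpow_add hs]; congr 1; ring
  rw [e1, e2, e3]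
  ring

lemma rpow_bd (e : ℝ) : ∃ M : ℝ, 0 < M ∧ ∀ x : ℝ, 1/8 ≤ x → x ≤ 2 → x ^ e ≤ M := by
  refine ⟨(1/8) ^ e + 2 ^ e, by positivity, fun x h1 h2 => ?_⟩
  have a1 : (0:ℝ) < (1/8) ^ e := by positivity
  have a2 : (0:ℝ) < 2 ^ e := by positivity
  rcases le_total 0 e with h | h
  · have := Real.rpow_le_rpow (by linarith) h2 h; linarith
  · have := Real.rpow_le_rpow_of_nonpos (by norm_num) h1 h; linarith

lemma S_bd {p s t : ℝ} (hp0 : 0 < p) (hp : p ≤ 2) (hs : 1/4 ≤ s) (hs1 : s ≤ 1) (ht : 1/4 ≤ t) (ht1 : t ≤ 1) :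
    1/8 ≤ s ^ p + t ^ p ∧ s ^ p + t ^ p ≤ 2 := by
  have h : ∀ x : ℝ, 1/4 ≤ x → x ≤ 1 → 1/16 ≤ x ^ p ∧ x ^ p ≤ 1 := by
    intro x h1 h2
    refine ⟨?_, Real.rpow_le_one (by linarith) h2 hp0.le⟩
    have a1 : x ^ (2:ℝ) ≤ x ^ p := Real.rpow_le_rpow_of_exponent_ge (by linarith) h2 hp
    rw [Real.rpow_two] at a1
    nlinarith
  have a := h s hs hs1
  have b := h t ht ht1
  constructor <;> linarith [a.1, a.2, b.1, b.2]

lemma sd_S {p : ℝ} (hp0 : 0 < p) (hp : p ≤ 2) (r : ℝ) : ∃ C : ℝ, 0 ≤ C ∧ ∀ s t δ : ℝ, 1/4 ≤ s → s ≤ 1 → 0 ≤ δ →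
    1/4 ≤ t - δ → t + δ ≤ 1 →
    |((t + δ) ^ p + s ^ p) ^ r - 2 * (t ^ p + s ^ p) ^ r + ((t - δ) ^ p + s ^ p) ^ r| ≤ C * δ ^ 2 := by
  obtain ⟨M1, hM1, b1⟩ := rpow_bd (p - 2)
  obtain ⟨M2, hM2, b2⟩ := rpow_bd (r - 1)
  obtain ⟨M3, hM3, b3⟩ := rpow_bd (2 * p - 2)
  obtain ⟨M4, hM4, b4⟩ := rpow_bd (r - 2)
  refine ⟨2 * (|r * p * (p - 1)| * M1 * M2 + |r * (r - 1) * p ^ 2| * M3 * M4), by positivity, ?_⟩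
  intro s t δ hs hs1 hδ ht ht1
  have := second_diff (f := fun t => (t ^ p + s ^ p) ^ r) (x := t) hδ
    (fun u hu => dS1 (by linarith [hu.1]) (by positivity))
    (fun u hu => dS2 (by linarith [hu.1]) (by positivity))
    (C := |r * p * (p - 1)| * M1 * M2 + |r * (r - 1) * p ^ 2| * M3 * M4) (fun u hu => by
      have hu1 : 1/4 ≤ u := by linarith [hu.1]
      have hu2 : u ≤ 1 := by linarith [hu.2]
      have hu0 : 0 < u := by linarith
      obtain ⟨c1, c2⟩ := S_bd hp0 hp hu1 hu2 hs hs1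
      refine (abs_add_le _ _).trans ?_
      rw [abs_mul, abs_mul, abs_mul (r * (r - 1) * p ^ 2 * _), abs_mul (r * (r - 1) * p ^ 2)]
      rw [abs_of_nonneg (by positivity : 0 ≤ u ^ (p - 2)), abs_of_nonneg (by positivity : 0 ≤ (u ^ p + s ^ p) ^ (r - 1)),
        abs_of_nonneg (by positivity : 0 ≤ u ^ (2 * p - 2)), abs_of_nonneg (by positivity : 0 ≤ (u ^ p + s ^ p) ^ (r - 2))]
      have := b1 u (by linarith) (by linarith)
      have := b2 _ c1 c2
      have := b3 u (by linarith) (by linarith)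
      have := b4 _ c1 c2
      gcongr)
  exact this

/-- mixed fourth difference of the smooth part. -/
lemma sd4_S {p : ℝ} (hp0 : 0 < p) (hp : p ≤ 2) (q : ℝ) : ∃ C : ℝ, 0 ≤ C ∧ ∀ s t δ : ℝ, 0 ≤ δ →
    1/4 ≤ s - δ → s + δ ≤ 1 → 1/4 ≤ t - δ → t + δ ≤ 1 → ∀ G : ℝ → ℝ,
    (∀ u, G u = (u ^ p + (t + δ) ^ p) ^ q - 2 * (u ^ p + t ^ p) ^ q + (u ^ p + (t - δ) ^ p) ^ q) →
    |G (s + δ) - 2 * G s + G (s - δ)| ≤ C * δ ^ 4 := by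
  obtain ⟨C1, hC1, hd1⟩ := sd_S hp0 hp (q - 1)
  obtain ⟨C2, hC2, hd2⟩ := sd_S hp0 hp (q - 2)
  obtain ⟨M1, hM1, b1⟩ := rpow_bd (p - 2)
  obtain ⟨M3, hM3, b3⟩ := rpow_bd (2 * p - 2)
  refine ⟨2 * (|q * p * (p - 1)| * M1 * C1 + |q * (q - 1) * p ^ 2| * M3 * C2), by positivity, ?_⟩
  intro s t δ hδ hs hs1 ht ht1 G hG
  have hGe : G = fun u => (u ^ p + (t + δ) ^ p) ^ q - 2 * (u ^ p + t ^ p) ^ q + (u ^ p + (t - δ) ^ p) ^ q := funext hG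
  have t1 : 0 ≤ (t + δ) ^ p := Real.rpow_nonneg (by linarith) _
  have t2 : 0 ≤ t ^ p := Real.rpow_nonneg (by linarith) _
  have t3 : 0 ≤ (t - δ) ^ p := Real.rpow_nonneg (by linarith) _
  have := second_diff (f := G) (x := s) hδ
    (fun u hu => by
      have hu0 : 0 < u := by linarith [hu.1]
      rw [hGe]
      exact ((dS1 hu0 t1).sub ((dS1 hu0 t2).const_mul 2)).add (dS1 hu0 t3))
    (fun u hu => by
      have hu0 : 0 < u := by linarith [hu.1]
      exact ((dS2 hu0 t1).sub ((dS2 hu0 t2).const_mul 2)).add (dS2 hu0 t3))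
    (C := (|q * p * (p - 1)| * M1 * C1 + |q * (q - 1) * p ^ 2| * M3 * C2) * δ ^ 2) (fun u hu => by
      have hu1 : 1/4 ≤ u := by linarith [hu.1]
      have hu2 : u ≤ 1 := by linarith [hu.2]
      have hu0 : 0 < u := by linarith
      have e1 := hd1 u t δ hu1 hu2 hδ ht ht1
      have e2 := hd2 u t δ hu1 hu2 hδ ht ht1
      rw [add_comm _ (u ^ p), add_comm _ (u ^ p), add_comm _ (u ^ p)] at e1 e2
      set d1 := (u ^ p + (t + δ) ^ p) ^ (q - 1) - 2 * (u ^ p + t ^ p) ^ (q - 1) + (u ^ p + (t - δ) ^ p) ^ (q - 1) with hdd1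
      set d2 := (u ^ p + (t + δ) ^ p) ^ (q - 2) - 2 * (u ^ p + t ^ p) ^ (q - 2) + (u ^ p + (t - δ) ^ p) ^ (q - 2) with hdd2
      have f1 := b1 u (by linarith) (by linarith)
      have f3 := b3 u (by linarith) (by linarith)
      calc _ = |q * p * (p - 1) * u ^ (p - 2) * d1 + q * (q - 1) * p ^ 2 * u ^ (2 * p - 2) * d2| := by
            congr 1; rw [hdd1, hdd2]; ring
        _ ≤ |q * p * (p - 1)| * u ^ (p - 2) * |d1| + |q * (q - 1) * p ^ 2| * u ^ (2 * p - 2) * |d2| := by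
            refine (abs_add_le _ _).trans (le_of_eq ?_)
            rw [abs_mul, abs_mul, abs_mul (q * (q - 1) * p ^ 2 * _), abs_mul (q * (q - 1) * p ^ 2),
              abs_of_nonneg (by positivity : 0 ≤ u ^ (p - 2)), abs_of_nonneg (by positivity : 0 ≤ u ^ (2 * p - 2))]
        _ ≤ |q * p * (p - 1)| * M1 * (C1 * δ ^ 2) + |q * (q - 1) * p ^ 2| * M3 * (C2 * δ ^ 2) := by gcongr
        _ = _ := by ring)
  refine this.trans (le_of_eq ?_)
  ring

/-- The fourth difference of `|x|^g`. -/
noncomputable def psi4 (g x : ℝ) : ℝ :=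
  |x + 2| ^ g - 4 * |x + 1| ^ g + 6 * |x| ^ g - 4 * |x - 1| ^ g + |x - 2| ^ g

lemma psi4_neg (g x : ℝ) : psi4 g (-x) = psi4 g x := by
  unfold psi4
  rw [abs_neg, show -x + 2 = -(x - 2) by ring, show -x + 1 = -(x - 1) by ring, show -x - 1 = -(x + 1) by ring,
    show -x - 2 = -(x + 2) by ring, abs_neg, abs_neg, abs_neg, abs_neg]
  ring

lemma dpow2 {c g x : ℝ} (hx : 0 < x) : HasDerivAt (fun x => c * x ^ g) (c * g * x ^ (g - 1)) x := by
  have := (Real.hasDerivAt_rpow_const (x := x) (p := g) (Or.inl hx.ne')).const_mul c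
  exact this.congr_deriv (by ring)

lemma sd_pow {c g x δ C : ℝ} (hδ : 0 ≤ δ) (hx : 0 < x - δ)
    (hC : ∀ u ∈ Set.Icc (x - δ) (x + δ), |c * g * (g - 1)| * u ^ (g - 2) ≤ C) :
    |c * (x + δ) ^ g - 2 * (c * x ^ g) + c * (x - δ) ^ g| ≤ 2 * C * δ ^ 2 :=
  second_diff (f := fun x => c * x ^ g) hδ (fun u hu => dpow2 (by linarith [hu.1]))
    (fun u hu => dpow2 (by linarith [hu.1])) (fun u hu => by
      have hu0 : 0 < u := by linarith [hu.1]
      rw [abs_mul, abs_of_nonneg (by positivity : 0 ≤ u ^ (g - 1 - 1)), show g - 1 - 1 = g - 2 by ring]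
      exact hC u hu)

lemma psi4_bd {g x : ℝ} (hg0 : 0 < g) (hg : g ≤ 2) (hx : 4 ≤ x) : |psi4 g x| ≤ 192 / x ^ 2 := by
  have e : psi4 g x = (fun y => (y + 1) ^ g - 2 * y ^ g + (y - 1) ^ g) (x + 1)
      - 2 * (fun y => (y + 1) ^ g - 2 * y ^ g + (y - 1) ^ g) x + (fun y => (y + 1) ^ g - 2 * y ^ g + (y - 1) ^ g) (x - 1) := by
    unfold psi4
    rw [abs_of_pos (by linarith), abs_of_pos (by linarith), abs_of_pos (by linarith), abs_of_pos (by linarith), abs_of_pos (by linarith)]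
    simp only
    rw [show x + 1 + 1 = x + 2 by ring, show x + 1 - 1 = x by ring, show x - 1 + 1 = x by ring, show x - 1 - 1 = x - 2 by ring]
    ring
  have d1 : ∀ {c g u : ℝ}, 1 < u → HasDerivAt (fun y => c * (y + 1) ^ g - 2 * (c * y ^ g) + c * (y - 1) ^ g)
      (c * g * (u + 1) ^ (g - 1) - 2 * (c * g * u ^ (g - 1)) + c * g * (u - 1) ^ (g - 1)) u := by
    intro c g u hu
    have h1 : HasDerivAt (fun y => c * (y + 1) ^ g) (c * g * (u + 1) ^ (g - 1)) u :=
      (dpow2 (x := u + 1) (by linarith)).comp_add_const u 1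
    have h2 : HasDerivAt (fun y => c * (y - 1) ^ g) (c * g * (u - 1) ^ (g - 1)) u :=
      (dpow2 (x := u - 1) (by linarith)).comp_sub_const u 1
    exact (h1.sub ((dpow2 (by linarith)).const_mul 2)).add h2
  rw [e]
  have := second_diff (f := fun y => (y + 1) ^ g - 2 * y ^ g + (y - 1) ^ g) (x := x) (δ := 1) (C := 96 / x ^ 2) (by norm_num)
    (fun u hu => by
      have := d1 (c := 1) (g := g) (u := u) (by linarith [hu.1])
      simpa only [one_mul] using this)
    (fun u hu => d1 (c := g) (u := u) (by linarith [hu.1]))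
    (fun u hu => by
      have hu1 : x - 1 ≤ u := hu.1
      have := sd_pow (c := g * (g - 1)) (g := g - 1 - 1) (x := u) (δ := 1) (C := 48 / x ^ 2) (by norm_num) (by linarith) (fun w hw => by
        have hw1 : u - 1 ≤ w := hw.1
        have hwx : x / 2 ≤ w := by linarith
        have hw0 : 0 < w := by linarith
        have a1 : |g * (g - 1) * (g - 1 - 1) * (g - 1 - 1 - 1)| ≤ 12 := by
          rw [abs_mul, abs_mul, abs_mul]
          have b1 : |g| ≤ 2 := by rw [abs_le]; constructor <;> linarith
          have b2 : |g - 1| ≤ 1 := by rw [abs_le]; constructor <;> linarith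
          have b3 : |g - 1 - 1| ≤ 2 := by rw [abs_le]; constructor <;> linarith
          have b4 : |g - 1 - 1 - 1| ≤ 3 := by rw [abs_le]; constructor <;> linarith
          calc _ ≤ (2:ℝ) * 1 * 2 * 3 := by gcongr
            _ = 12 := by norm_num
        have a2 : w ^ (g - 1 - 1 - 2) ≤ w ^ (-2:ℝ) := Real.rpow_le_rpow_of_exponent_le (by linarith) (by linarith)
        have a3 : w ^ (-2:ℝ) ≤ (x / 2) ^ (-2:ℝ) := Real.rpow_le_rpow_of_nonpos (by linarith) hwx (by norm_num)
        have a4 : (x / 2) ^ (-2:ℝ) = 4 / x ^ 2 := by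
          rw [Real.rpow_neg (by linarith), Real.rpow_two]; field_simp; norm_num
        calc _ ≤ 12 * (4 / x ^ 2) := by
              rw [← a4]
              apply mul_le_mul a1 (a2.trans a3) (by positivity) (by norm_num)
          _ = _ := by ring)
      refine le_trans this (le_of_eq ?_)
      ring)
  refine this.trans (le_of_eq ?_)
  ring

end Part9

section Part10
open scoped ENNReal NNReal Pointwise
open Filter Topology

lemma sum_inv_sq (n : ℕ) : ∑ k ∈ Finset.range n, 1 / (k:ℝ) ^ 2 ≤ 2 := by
  have h : ∀ n : ℕ, ∑ k ∈ Finset.range (n + 2), 1 / (k:ℝ) ^ 2 ≤ 2 - 1 / ((n:ℝ) + 1) := by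
    intro n
    induction n with
    | zero => simp [Finset.sum_range_succ]; norm_num
    | succ n ih =>
      rw [Finset.sum_range_succ]
      refine (add_le_add_left ih _).trans ?_
      push_cast
      have : 1 / ((n:ℝ) + 2) ^ 2 ≤ 1 / ((n:ℝ) + 1) - 1 / ((n:ℝ) + 1 + 1) := by
        rw [div_sub_div _ _ (by positivity) (by positivity), div_le_div_iff₀ (by positivity) (by positivity)]
        nlinarith [(Nat.cast_nonneg n : (0:ℝ) ≤ n)]
      linarith
  calc _ ≤ ∑ k ∈ Finset.range (n + 2), 1 / (k:ℝ) ^ 2 :=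
        Finset.sum_le_sum_of_subset_of_nonneg (Finset.range_mono (by omega)) (fun _ _ _ => by positivity)
    _ ≤ _ := h n
    _ ≤ 2 := by have : 0 ≤ 1 / ((n:ℝ) + 1) := by positivity
                linarith

lemma sum_inv_sq_diff (N : ℕ) (i : Fin N) : ∑ j : Fin N, 1 / (((i:ℕ):ℝ) - ((j:ℕ):ℝ)) ^ 2 ≤ 4 := by
  rw [Fin.sum_univ_eq_sum_range (fun j => 1 / (((i:ℕ):ℝ) - (j:ℝ)) ^ 2) N]
  obtain ⟨m, hm⟩ : ∃ m, N = (i:ℕ) + m := ⟨N - i, by omega⟩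
  generalize (i:ℕ) = k at hm
  subst hm
  rw [Finset.sum_range_add]
  have h1 : ∑ x ∈ Finset.range m, 1 / ((k:ℝ) - ((k + x : ℕ):ℝ)) ^ 2 ≤ 2 := by
    refine le_trans (le_of_eq (Finset.sum_congr rfl fun x _ => ?_)) (sum_inv_sq m)
    push_cast; congr 1; ring
  have h2 : ∑ x ∈ Finset.range k, 1 / ((k:ℝ) - (x:ℝ)) ^ 2 ≤ 2 := by
    rw [← Finset.sum_range_reflect]
    refine le_trans (le_of_eq ?_) (sum_inv_sq (k + 1))
    rw [Finset.sum_range_succ']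
    simp only [Nat.cast_zero, ne_eq, OfNat.ofNat_ne_zero, not_false_eq_true, zero_pow, div_zero, add_zero]
    refine Finset.sum_congr rfl fun x hx => ?_
    have := Finset.mem_range.1 hx
    rw [Nat.sub_sub, Nat.cast_sub (by omega)]
    push_cast; congr 1; ring
  linarith

lemma diag_dom {ι : Type*} [Fintype ι] [DecidableEq ι] (C r : ι → ι → ℝ) (d ρ : ℝ)
    (hr : ∀ i j, r i j = r j i)
    (hC : ∀ i j, |C i j - if i = j then d else 0| ≤ r i j) (hρ : ∀ i, ∑ j, r i j ≤ ρ) (a : ι → ℝ) :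
    (d - ρ) * ∑ i, a i ^ 2 ≤ ∑ i, ∑ j, a i * a j * C i j := by
  have h1 : ∀ i j, (if i = j then d * a i ^ 2 else 0) - r i j * (a i ^ 2 + a j ^ 2) / 2 ≤ a i * a j * C i j := by
    intro i j
    have h := hC i j
    set E := C i j - if i = j then d else 0 with hE
    have h2 : a i * a j * C i j = (if i = j then d * a i ^ 2 else 0) + a i * a j * E := by
      rw [hE]
      by_cases hij : i = j
      · subst hij; simp; ring
      · simp [hij]
    rw [h2]
    have h3 : |a i * a j * E| ≤ r i j * (a i ^ 2 + a j ^ 2) / 2 := by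
      rw [abs_mul]
      have : |a i * a j| ≤ (a i ^ 2 + a j ^ 2) / 2 := by
        rw [abs_le]; constructor <;> nlinarith [sq_nonneg (a i + a j), sq_nonneg (a i - a j)]
      calc _ ≤ (a i ^ 2 + a j ^ 2) / 2 * r i j := mul_le_mul this h (abs_nonneg _) (by positivity)
        _ = _ := by ring
    linarith [(abs_le.1 h3).1]
  refine le_trans ?_ (Finset.sum_le_sum fun i _ => Finset.sum_le_sum fun j _ => h1 i j)
  simp only [Finset.sum_sub_distrib, Finset.sum_ite_eq, Finset.mem_univ, if_true, ← Finset.mul_sum]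
  have e1 : ∑ i, ∑ j, r i j * (a i ^ 2 + a j ^ 2) / 2 = ∑ i, (∑ j, r i j) * a i ^ 2 := by
    have : ∀ i j, r i j * (a i ^ 2 + a j ^ 2) / 2 = r i j * a i ^ 2 / 2 + r i j * a j ^ 2 / 2 := fun i j => by ring
    simp only [this, Finset.sum_add_distrib]
    rw [Finset.sum_comm (f := fun i j => r i j * a j ^ 2 / 2)]
    simp only [← Finset.sum_add_distrib, Finset.sum_mul]
    refine Finset.sum_congr rfl fun i _ => Finset.sum_congr rfl fun j _ => ?_
    rw [hr j i]; ring
  rw [e1, sub_mul]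
  have e2 : ∑ i, (∑ j, r i j) * a i ^ 2 ≤ ρ * ∑ i, a i ^ 2 := by
    rw [Finset.mul_sum]
    exact Finset.sum_le_sum fun i _ => mul_le_mul_of_nonneg_right (hρ i) (sq_nonneg _)
  linarith

noncomputable def Csd (H K δ s t : ℝ) : ℝ :=
  (Rbif H K (s + δ) (t + δ) - 2 * Rbif H K (s + δ) t + Rbif H K (s + δ) (t - δ))
  - 2 * (Rbif H K s (t + δ) - 2 * Rbif H K s t + Rbif H K s (t - δ))
  + (Rbif H K (s - δ) (t + δ) - 2 * Rbif H K (s - δ) t + Rbif H K (s - δ) (t - δ))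

lemma bif_sd_map {Ω : Type*} [MeasurableSpace Ω] {μ : Measure Ω} [IsProbabilityMeasure μ] {H K : ℝ} {B : ℝ → Ω → ℝ}
    (hB : IsBifBM μ H K B) {ι : Type*} [Fintype ι] (t : ι → ℝ) (δ : ℝ) (hδ : 0 ≤ δ) (ht : ∀ i, 0 ≤ t i - δ) (a : ι → ℝ) :
    Measure.map (fun ω => ∑ i, a i * (B (t i + δ) ω - 2 * B (t i) ω + B (t i - δ) ω)) μ =
      gaussianReal 0 (Real.toNNReal (∑ i, ∑ j, a i * a j * Csd H K δ (t i) (t j))) := by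
  have := bif_map hB (fun x : ι × Fin 3 => t x.1 + ![δ, 0, -δ] x.2) (by
    rintro ⟨i, k⟩
    have := ht i
    fin_cases k <;> simp <;> linarith) (fun x : ι × Fin 3 => a x.1 * ![1, -2, 1] x.2)
  have e1 : (fun ω => ∑ i, a i * (B (t i + δ) ω - 2 * B (t i) ω + B (t i - δ) ω)) =
      fun ω => ∑ x : ι × Fin 3, a x.1 * ![1, -2, 1] x.2 * B (t x.1 + ![δ, 0, -δ] x.2) ω := by
    funext ω
    rw [Fintype.sum_prod_type]
    refine Finset.sum_congr rfl fun i _ => ?_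
    rw [Fin.sum_univ_three]
    simp [sub_eq_add_neg]; ring
  rw [e1, this]
  congr 2
  rw [Fintype.sum_prod_type]
  refine Finset.sum_congr rfl fun i _ => ?_
  rw [Finset.sum_comm' (t' := Finset.univ) (s' := fun _ => Finset.univ) (by simp), Fintype.sum_prod_type]
  refine Finset.sum_congr rfl fun j _ => ?_
  simp only [Fin.sum_univ_three]
  simp [Csd, sub_eq_add_neg]; ring

lemma Csd_eq {H K δ s t : ℝ} (hδ : 0 < δ) (x : ℝ) (hx : t - s = δ * x) : ∀ G : ℝ → ℝ,
    (∀ u, G u = (u ^ (2*H) + (t + δ) ^ (2*H)) ^ K - 2 * (u ^ (2*H) + t ^ (2*H)) ^ K + (u ^ (2*H) + (t - δ) ^ (2*H)) ^ K) →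
    Csd H K δ s t = 2 ^ (-K) * ((G (s + δ) - 2 * G s + G (s - δ)) - δ ^ (2 * H * K) * psi4 (2 * H * K) x) := by
  intro G hG
  have hk : ∀ k : ℝ, ∀ y, y = δ * (x + k) → |y| ^ (2 * H * K) = δ ^ (2 * H * K) * |x + k| ^ (2 * H * K) := by
    intro k y hy
    rw [hy, abs_mul, abs_of_pos hδ, Real.mul_rpow hδ.le (abs_nonneg _)]
  unfold Csd Rbif psi4
  rw [hG, hG, hG]
  rw [hk 0 (t + δ - (s + δ)) (by linarith), hk (-1) (t - (s + δ)) (by linarith), hk (-2) (t - δ - (s + δ)) (by linarith),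
    hk 1 (t + δ - s) (by linarith), hk 0 (t - s) (by linarith), hk (-1) (t - δ - s) (by linarith),
    hk 2 (t + δ - (s - δ)) (by linarith), hk 1 (t - (s - δ)) (by linarith), hk 0 (t - δ - (s - δ)) (by linarith)]
  simp only [add_zero, ← sub_eq_add_neg]
  simp only [add_comm ((_:ℝ) ^ (2 * H)) ((s + δ) ^ (2 * H)), add_comm ((_:ℝ) ^ (2 * H)) ((s) ^ (2 * H)), add_comm ((_:ℝ) ^ (2 * H)) ((s - δ) ^ (2 * H))]
  ring

end Part10

section Part11
open scoped ENNReal NNReal Pointwise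
open Filter Topology

lemma psi4_zero {g : ℝ} (hg : 0 < g) : psi4 g 0 = -(8 - 2 * 2 ^ g) := by
  unfold psi4
  simp [Real.zero_rpow hg.ne']
  ring

lemma psi4_bd_int {g : ℝ} (hg0 : 0 < g) (hg : g ≤ 2) {M : ℝ} (hM : 4 ≤ M) {i j : ℕ} (hij : i ≠ j) :
    |psi4 g (M * ((j:ℝ) - i))| ≤ 192 / M ^ 2 * (1 / ((i:ℝ) - j) ^ 2) := by
  have key : ∀ a b : ℕ, a < b → |psi4 g (M * ((b:ℝ) - a))| ≤ 192 / M ^ 2 * (1 / ((b:ℝ) - a) ^ 2) := by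
    intro a b hab
    have h1 : (1:ℝ) ≤ (b:ℝ) - a := by
      have : ((a + 1 : ℕ):ℝ) ≤ b := by exact_mod_cast hab
      push_cast at this; linarith
    refine (psi4_bd hg0 hg (by nlinarith)).trans (le_of_eq ?_)
    rw [mul_pow]; field_simp
  rcases lt_or_gt_of_ne hij with h | h
  · refine (key i j h).trans (le_of_eq ?_)
    congr 2; ring
  · rw [← psi4_neg, show -(M * ((j:ℝ) - i)) = M * ((i:ℝ) - j) by ring]
    exact key j i h

lemma sd_quad {H K : ℝ} (hH : H ∈ Set.Ioo (0:ℝ) 1) (hK : K ∈ Set.Ioc (0:ℝ) 1) :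
    ∃ κ : ℝ, 0 < κ ∧ ∃ M : ℕ, 4 ≤ M ∧ ∀ N : ℕ, 1 ≤ N → ∀ δ : ℝ, δ = 1 / (2 * M * N) → ∀ t : Fin N → ℝ,
      (∀ i, t i = 1 / 2 + (i:ℕ) * (M * δ)) → ∀ a : Fin N → ℝ,
      κ * δ ^ (2 * H * K) * ∑ i, a i ^ 2 ≤ ∑ i, ∑ j, a i * a j * Csd H K δ (t i) (t j) := by
  obtain ⟨h0, h1⟩ := hH
  obtain ⟨k0, k1⟩ := hK
  have hg0 : 0 < 2 * H * K := by positivity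
  have hg : 2 * H * K < 2 := by nlinarith
  obtain ⟨C, hC0, hC⟩ := sd4_S (p := 2 * H) (by linarith) (by linarith) K
  set κ0 : ℝ := 8 - 2 * 2 ^ (2 * H * K) with hκ0
  have hκp : 0 < κ0 := by
    have : (2:ℝ) ^ (2 * H * K) < 2 ^ (2:ℝ) := Real.rpow_lt_rpow_of_exponent_lt (by norm_num) hg
    rw [Real.rpow_two] at this
    rw [hκ0]; linarith
  obtain ⟨M, hM⟩ := exists_nat_ge (4 + C / κ0 + 3072 / κ0)
  have hCk : 0 ≤ C / κ0 := by positivity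
  have hCk2 : 0 ≤ 3072 / κ0 := by positivity
  have hM4 : (4:ℝ) ≤ M := by linarith
  refine ⟨2 ^ (-K) * (κ0 / 2), by positivity, M, by exact_mod_cast hM4, ?_⟩
  intro N hN δ hδ t ht a
  have hN1 : (1:ℝ) ≤ N := by exact_mod_cast hN
  have hδ0 : 0 < δ := by rw [hδ]; positivity
  have hMNδ : M * N * δ = 1 / 2 := by rw [hδ]; field_simp
  have hMδ : M * δ ≤ 1 / 2 := by nlinarith [mul_pos (by linarith : (0:ℝ) < M) hδ0]
  have hδ8 : δ ≤ 1 / 8 := by nlinarith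
  set L : ℝ := 2 ^ (-K) * δ ^ (2 * H * K) with hL
  have hL0 : 0 < L := by positivity
  have hδg : δ ^ 2 ≤ δ ^ (2 * H * K) := by
    rw [← Real.rpow_two]; exact Real.rpow_le_rpow_of_exponent_ge hδ0 (by linarith) hg.le
  have htl : ∀ i, 1 / 4 ≤ t i - δ := fun i => by
    rw [ht]; have : 0 ≤ ((i:ℕ):ℝ) * (M * δ) := by positivity
    linarith
  have htu : ∀ i, t i + δ ≤ 1 := fun i => by
    have hi : ((i:ℕ):ℝ) + 1 ≤ N := by exact_mod_cast i.2
    rw [ht]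
    have : (((i:ℕ):ℝ) + 1) * (M * δ) ≤ N * (M * δ) := mul_le_mul_of_nonneg_right hi (by positivity)
    have : δ ≤ M * δ := by nlinarith
    nlinarith
  have := diag_dom (fun i j => Csd H K δ (t i) (t j))
    (fun i j : Fin N => L * (C * δ ^ 2 + 192 / (M:ℝ) ^ 2 * (1 / (((i:ℕ):ℝ) - ((j:ℕ):ℝ)) ^ 2))) (L * κ0) (L * (κ0 / 2))
    (fun i j => by
      rw [← neg_sub ((i:ℕ):ℝ), neg_sq])
    (fun i j => by
      have hx : t j - t i = δ * (M * (((j:ℕ):ℝ) - ((i:ℕ):ℝ))) := by rw [ht, ht]; ring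
      rw [Csd_eq hδ0 _ hx _ (fun u => rfl)]
      have hb := hC (t i) (t j) δ hδ0.le (htl i) (htu i) (htl j) (htu j) _ (fun u => rfl)
      generalize ((t i + δ) ^ (2 * H) + (t j + δ) ^ (2 * H)) ^ K -
            2 * ((t i + δ) ^ (2 * H) + t j ^ (2 * H)) ^ K +
          ((t i + δ) ^ (2 * H) + (t j - δ) ^ (2 * H)) ^ K -
        2 *
          ((t i ^ (2 * H) + (t j + δ) ^ (2 * H)) ^ K - 2 * (t i ^ (2 * H) + t j ^ (2 * H)) ^ K +
            (t i ^ (2 * H) + (t j - δ) ^ (2 * H)) ^ K) +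
      (((t i - δ) ^ (2 * H) + (t j + δ) ^ (2 * H)) ^ K -
          2 * ((t i - δ) ^ (2 * H) + t j ^ (2 * H)) ^ K +
        ((t i - δ) ^ (2 * H) + (t j - δ) ^ (2 * H)) ^ K) = D at hb ⊢
      have hD : |D| ≤ δ ^ (2 * H * K) * (C * δ ^ 2) := by
        refine hb.trans ?_
        calc C * δ ^ 4 = δ ^ 2 * (C * δ ^ 2) := by ring
          _ ≤ _ := by gcongr
      by_cases hij : i = j
      · subst hij
        simp only [sub_self, mul_zero, if_true]
        rw [psi4_zero hg0, ← hκ0]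
        calc _ = |2 ^ (-K) * D| := by congr 1; rw [hL]; ring
          _ = 2 ^ (-K) * |D| := by rw [abs_mul, abs_of_pos (by positivity)]
          _ ≤ 2 ^ (-K) * (δ ^ (2 * H * K) * (C * δ ^ 2)) := by gcongr
          _ = _ := by rw [hL]; simp; ring
      · rw [if_neg hij, sub_zero, abs_mul, abs_of_pos (by positivity : (0:ℝ) < 2 ^ (-K))]
        have hp := psi4_bd_int hg0 hg.le hM4 (i := (i:ℕ)) (j := (j:ℕ)) (fun h => hij (Fin.ext h))
        calc _ ≤ 2 ^ (-K) * (|D| + |δ ^ (2 * H * K) * psi4 (2 * H * K) (M * (((j:ℕ):ℝ) - ((i:ℕ):ℝ)))|) := by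
              gcongr; exact abs_sub _ _
          _ ≤ 2 ^ (-K) * (δ ^ (2 * H * K) * (C * δ ^ 2) + δ ^ (2 * H * K) * (192 / (M:ℝ) ^ 2 * (1 / (((i:ℕ):ℝ) - ((j:ℕ):ℝ)) ^ 2))) := by
              rw [abs_mul, abs_of_pos (by positivity : (0:ℝ) < δ ^ (2 * H * K))]
              gcongr
          _ = _ := by rw [hL]; ring)
    (fun i => by
      rw [← Finset.mul_sum, Finset.sum_add_distrib]
      have hs := sum_inv_sq_diff N i
      refine mul_le_mul_of_nonneg_left ?_ hL0.le
      simp only [Finset.sum_const, Finset.card_univ, Fintype.card_fin, nsmul_eq_mul]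
      have hMM : (M:ℝ) ≤ M ^ 2 := by nlinarith
      have q1 : N * (C * δ ^ 2) ≤ κ0 / 4 := by
        have c1 : C ≤ M * κ0 := by
          have : C / κ0 ≤ M := by linarith
          rwa [div_le_iff₀ hκp] at this
        calc N * (C * δ ^ 2) ≤ N * ((M * κ0) * δ ^ 2) := by gcongr
          _ = (M * N * δ) * δ * κ0 := by ring
          _ = δ / 2 * κ0 := by rw [hMNδ]; ring
          _ ≤ κ0 / 4 := by nlinarith
      have q2 : 192 / (M:ℝ) ^ 2 * ∑ j : Fin N, 1 / (((i:ℕ):ℝ) - ((j:ℕ):ℝ)) ^ 2 ≤ κ0 / 4 := by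
        have c1 : 3072 ≤ M * κ0 := by
          have : 3072 / κ0 ≤ M := by linarith
          rwa [div_le_iff₀ hκp] at this
        calc _ ≤ 192 / (M:ℝ) ^ 2 * 4 := by gcongr
          _ = 768 / (M:ℝ) ^ 2 := by ring
          _ ≤ κ0 / 4 := by
            rw [div_le_iff₀ (by positivity)]
            nlinarith
      rw [Finset.mul_sum] at q2
      linarith) a
  refine le_trans (le_of_eq ?_) this
  rw [hL]; ring

end Part11

section Part12
open scoped ENNReal NNReal Pointwise
open Filter Topology

section upper
variable {Ω : Type*} [MeasurableSpace Ω] {μ : Measure Ω} [IsProbabilityMeasure μ] {H K α : ℝ}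
  {B : ℝ → Ω → ℝ}

lemma bif_ball_sub (hH : H ∈ Set.Ioo (0:ℝ) 1) (hK : K ∈ Set.Ioc (0:ℝ) 1) (hB : IsBifBM μ H K B)
    (hα : α ∈ Set.Ioo 0 (H * K)) {ε : ℝ} {S : Set Ω}
    (hS : ∀ ω, (∀ s ∈ Set.Icc (0:ℝ) 1, ∀ t ∈ Set.Icc (0:ℝ) 1, |B s ω - B t ω| ≤ ε * |s - t| ^ α) → ω ∈ S) :
    μ {ω | holderNorm α (fun t => B t ω) ≤ ε} ≤ μ S := by
  refine measure_mono_ae ?_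
  filter_upwards [bif_as_holder hH hK hB hα] with ω hω hn
  obtain ⟨c, hc⟩ := hω
  exact hS ω (le_of_holderNorm hα.1 hc hn)

lemma bif_upper_N (hH : H ∈ Set.Ioo (0:ℝ) 1) (hK : K ∈ Set.Ioc (0:ℝ) 1) (hB : IsBifBM μ H K B)
    (hα : α ∈ Set.Ioo 0 (H * K)) : ∃ A : ℝ, 0 < A ∧ ∀ ε > 0, ∀ N : ℕ, 1 ≤ N →
    μ {ω | holderNorm α (fun t => B t ω) ≤ ε} ≤ ENNReal.ofReal ((A * Real.exp (-1) * ε * (N:ℝ) ^ (H * K - α)) ^ N) := by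
  obtain ⟨κ, hκ, M, hM, hq⟩ := sd_quad hH hK
  have hM4 : (4:ℝ) ≤ M := by exact_mod_cast hM
  refine ⟨Real.exp 1 * (Real.exp (1/2) * (2 / Real.sqrt κ) * (2 * M) ^ (H * K - α)), by positivity, ?_⟩
  intro ε hε N hN
  have hN1 : (1:ℝ) ≤ N := by exact_mod_cast hN
  set δ : ℝ := 1 / (2 * M * N) with hδ
  have hδ0 : 0 < δ := by rw [hδ]; positivity
  have hMNδ : M * N * δ = 1 / 2 := by rw [hδ]; field_simp
  have hMδ : M * δ ≤ 1 / 2 := by nlinarith [mul_pos (by linarith : (0:ℝ) < M) hδ0]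
  have hδ8 : δ ≤ 1 / 8 := by nlinarith
  set t : Fin N → ℝ := fun i => 1 / 2 + (i:ℕ) * (M * δ) with ht
  have htl : ∀ i, 1 / 4 ≤ t i - δ := fun i => by
    have : 0 ≤ ((i:ℕ):ℝ) * (M * δ) := by positivity
    simp only [ht]
    linarith
  have htu : ∀ i, t i + δ ≤ 1 := fun i => by
    have hi : ((i:ℕ):ℝ) + 1 ≤ N := by exact_mod_cast i.2
    simp only [ht]
    have : (((i:ℕ):ℝ) + 1) * (M * δ) ≤ N * (M * δ) := mul_le_mul_of_nonneg_right hi (by positivity)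
    have : δ ≤ M * δ := by nlinarith
    nlinarith
  have hbox := gauss_box μ (fun i ω => B (t i + δ) ω - 2 * B (t i) ω + B (t i - δ) ω)
    (fun i => (((bif_aem hB (by linarith [htl i])).sub ((bif_aem hB (by linarith [htl i])).const_mul 2))).add
      (bif_aem hB (by linarith [htl i]))) _
    (fun a => bif_sd_map hB t δ hδ0.le (fun i => by linarith [htl i]) a) (l := κ * δ ^ (2 * H * K)) (η := 2 * ε * δ ^ α)
    (by positivity) (by positivity) (fun a => hq N hN δ hδ t (fun i => rfl) a)
  refine (bif_ball_sub hH hK hB hα (S := {ω | ∀ i, |B (t i + δ) ω - 2 * B (t i) ω + B (t i - δ) ω| ≤ 2 * ε * δ ^ α}) ?_).trans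
    (hbox.trans (le_of_eq ?_))
  · intro ω hω i
    have a1 := htl i
    have a2 := htu i
    have e1 := hω (t i + δ) ⟨by linarith, by linarith⟩ (t i) ⟨by linarith, by linarith⟩
    have e2 := hω (t i - δ) ⟨by linarith, by linarith⟩ (t i) ⟨by linarith, by linarith⟩
    rw [show t i + δ - t i = δ by ring, abs_of_pos hδ0] at e1
    rw [show t i - δ - t i = -δ by ring, abs_neg, abs_of_pos hδ0] at e2
    calc _ = |(B (t i + δ) ω - B (t i) ω) + (B (t i - δ) ω - B (t i) ω)| := by congr 1; ring
      _ ≤ _ := abs_add_le _ _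
      _ ≤ _ := by linarith
  · rw [Fintype.card_fin]
    congr 2
    have s1 : Real.sqrt (κ * δ ^ (2 * H * K)) = Real.sqrt κ * δ ^ (H * K) := by
      rw [Real.sqrt_mul hκ.le, show 2 * H * K = H * K * 2 by ring, Real.rpow_mul hδ0.le, Real.rpow_two,
        Real.sqrt_sq (by positivity)]
    have s2 : δ ^ α / δ ^ (H * K) = (2 * M) ^ (H * K - α) * (N:ℝ) ^ (H * K - α) := by
      rw [← Real.rpow_sub hδ0, ← Real.mul_rpow (by positivity) (by positivity), hδ, one_div,
        Real.inv_rpow (by positivity), ← Real.rpow_neg (by positivity)]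
      congr 1; ring
    have s3 : Real.exp 1 * Real.exp (-1) = 1 := by rw [← Real.exp_add]; simp
    rw [s1]
    calc _ = Real.exp (1/2) * (2 / Real.sqrt κ) * ε * (δ ^ α / δ ^ (H * K)) := by
          field_simp
      _ = (Real.exp 1 * Real.exp (-1)) * (Real.exp (1/2) * (2 / Real.sqrt κ) * ε * (δ ^ α / δ ^ (H * K))) := by
          rw [s3, one_mul]
      _ = _ := by rw [s2]; ring

lemma bif_one_lt (hH : H ∈ Set.Ioo (0:ℝ) 1) (hK : K ∈ Set.Ioc (0:ℝ) 1) (hB : IsBifBM μ H K B)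
    (hα : α ∈ Set.Ioo 0 (H * K)) : ∃ p : ℝ, 0 < p ∧ p < 1 ∧ ∀ ε ≤ 1, 
    μ {ω | holderNorm α (fun t => B t ω) ≤ ε} ≤ ENNReal.ofReal p := by
  have h0 := hH.1
  have k0 := hK.1
  have hm := bif_incr_one hB (s := 0) (t := 1) le_rfl zero_le_one
  have hv : Rbif H K 1 1 - Rbif H K 1 0 - Rbif H K 0 1 + Rbif H K 0 0 = 1 := by
    have z1 : (0:ℝ) ^ (2 * H) = 0 := Real.zero_rpow (by positivity)
    have z2 : (0:ℝ) ^ (2 * H * K) = 0 := Real.zero_rpow (by positivity)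
    have z3 : (0:ℝ) ^ K = 0 := Real.zero_rpow (by positivity)
    unfold Rbif
    simp [z1, z2, z3]
    rw [show (1:ℝ) + 1 = 2 by norm_num, ← Real.rpow_add (by norm_num)]; simp
  rw [hv, Real.toNNReal_one] at hm
  have hlt : gaussianReal 0 1 (Set.Icc (-1) 1) < 1 := by
    have hc : 0 < gaussianReal 0 1 (Set.Ioi (1:ℝ)) := by
      have hopen := (gaussianReal_absolutelyContinuous' 0 (v := 1) one_ne_zero)
      rw [pos_iff_ne_zero]
      intro h
      have := hopen h
      simp at this
    have : gaussianReal 0 1 (Set.Icc (-1) 1) + gaussianReal 0 1 (Set.Ioi (1:ℝ)) ≤ 1 := by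
      rw [← measure_union (by
        rw [Set.disjoint_left]; intro x hx hx'; exact absurd hx.2 (not_le.2 hx')) measurableSet_Ioi]
      exact prob_le_one
    calc _ < gaussianReal 0 1 (Set.Icc (-1) 1) + gaussianReal 0 1 (Set.Ioi (1:ℝ)) :=
          ENNReal.lt_add_right (measure_ne_top _ _) hc.ne'
      _ ≤ 1 := this
  refine ⟨max (gaussianReal 0 1 (Set.Icc (-1) 1)).toReal (1/2), lt_max_of_lt_right (by norm_num), ?_, ?_⟩
  · refine max_lt ?_ (by norm_num)
    have := (ENNReal.toReal_lt_toReal (measure_ne_top _ _) ENNReal.one_ne_top).2 hlt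
    simpa using this
  · intro ε hε
    refine (bif_ball_sub hH hK hB hα (S := (fun ω => B 1 ω - B 0 ω) ⁻¹' (Set.Icc (-1) 1)) ?_).trans ?_
    · intro ω hω
      have := hω 1 (by simp) 0 (by simp)
      simp only [sub_zero, abs_one, Real.one_rpow, mul_one] at this
      exact abs_le.1 (this.trans hε)
    · have hae : AEMeasurable (fun ω => B 1 ω - B 0 ω) μ := (bif_aem hB zero_le_one).sub (bif_aem hB le_rfl)
      rw [← Measure.map_apply_of_aemeasurable hae measurableSet_Icc]
      rw [hm]
      refine (ENNReal.ofReal_toReal (measure_ne_top _ _)).symm.le.trans ?_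
      exact ENNReal.ofReal_le_ofReal (le_max_left _ _)

lemma bif_upper (hH : H ∈ Set.Ioo (0:ℝ) 1) (hK : K ∈ Set.Ioc (0:ℝ) 1) (hB : IsBifBM μ H K B)
    (hα : α ∈ Set.Ioo 0 (H * K)) : ∃ c : ℝ, 0 < c ∧ ∀ ε ∈ Set.Ioo (0:ℝ) 1, 
    μ {ω | holderNorm α (fun t => B t ω) ≤ ε} ≤
      ENNReal.ofReal (Real.exp (-c * ε ^ (-(1 / (H * K - α))))) := by
  obtain ⟨A, hA, hN⟩ := bif_upper_N hH hK hB hα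
  obtain ⟨p, hp0, hp1, hp⟩ := bif_one_lt hH hK hB hα
  have hβ : 0 < H * K - α := by linarith [hα.2]
  set β := H * K - α with hβd
  set D : ℝ := A ^ (-(1 / β)) with hD
  have hD0 : 0 < D := by positivity
  have hlog : 0 < -Real.log p := by linarith [Real.log_neg hp0 hp1]
  refine ⟨min (D / 2) (-Real.log p * D), by positivity, ?_⟩
  intro ε hε
  have hε0 : 0 < ε := hε.1
  set y : ℝ := ε ^ (-(1 / β)) with hy
  have hy0 : 0 < y := by positivity
  have hx : (A * ε) ^ (-(1 / β)) = D * y := Real.mul_rpow hA.le hε0.le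
  rcases le_or_gt 1 (D * y) with h | h
  · have hfl : 1 ≤ ⌊D * y⌋₊ := (Nat.one_le_floor_iff _).2 h
    have hfle : (⌊D * y⌋₊:ℝ) ≤ D * y := Nat.floor_le (by positivity)
    have hflt : D * y < ⌊D * y⌋₊ + 1 := Nat.lt_floor_add_one _
    set N := ⌊D * y⌋₊ with hNd
    have hN1 : (1:ℝ) ≤ N := by exact_mod_cast hfl
    refine (hN ε hε0 N hfl).trans (ENNReal.ofReal_le_ofReal ?_)
    have hb : (N:ℝ) ^ β ≤ (A * ε)⁻¹ := by
      calc (N:ℝ) ^ β ≤ (D * y) ^ β := Real.rpow_le_rpow (by positivity) hfle hβ.le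
        _ = (A * ε)⁻¹ := by
          rw [← hx, ← Real.rpow_mul (by positivity), show -(1 / β) * β = -1 by field_simp, Real.rpow_neg_one]
    have hb2 : A * Real.exp (-1) * ε * (N:ℝ) ^ β ≤ Real.exp (-1) := by
      calc A * Real.exp (-1) * ε * (N:ℝ) ^ β ≤ A * Real.exp (-1) * ε * (A * ε)⁻¹ := by gcongr
        _ = Real.exp (-1) := by field_simp
    calc _ ≤ Real.exp (-1) ^ N := by gcongr
      _ = Real.exp (-N) := by rw [← Real.exp_nat_mul]; simp
      _ ≤ _ := by
        rw [Real.exp_le_exp]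
        have : min (D / 2) (-Real.log p * D) * y ≤ D / 2 * y := by gcongr; exact min_le_left _ _
        linarith
  · refine (hp ε hε.2.le).trans (ENNReal.ofReal_le_ofReal ?_)
    rw [← Real.exp_log hp0] 
    rw [Real.exp_le_exp, Real.log_exp]
    have : min (D / 2) (-Real.log p * D) * y ≤ -Real.log p * D * y := by gcongr; exact min_le_right _ _
    nlinarith

end upper

end Part12

/-- Proposition 3.6, small ball probability under the Hölder norm:
for `α ∈ (0, HK)` there exist `c₁₃, c₁₄ > 0` such that for all `ε ∈ (0,1)`,
`exp(-c₁₃ ε^{-1/(HK-α)}) ≤ P{‖B^{H,K}‖_α ≤ ε} ≤ exp(-c₁₄ ε^{-1/(HK-α)})`. -/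
theorem bifBM_holder_small_ball {Ω : Type*} [MeasurableSpace Ω] (μ : Measure Ω)
    [IsProbabilityMeasure μ] (H K : ℝ) (hH : H ∈ Set.Ioo (0:ℝ) 1)
    (hK : K ∈ Set.Ioc (0:ℝ) 1) (B : ℝ → Ω → ℝ) (hB : IsBifBM μ H K B)
    (α : ℝ) (hα : α ∈ Set.Ioo 0 (H * K)) :
    ∃ c₁₃ c₁₄ : ℝ, 0 < c₁₃ ∧ 0 < c₁₄ ∧ ∀ ε ∈ Set.Ioo (0:ℝ) 1,
      ENNReal.ofReal (Real.exp (-c₁₃ * ε ^ (-(1 / (H * K - α))))) ≤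
          μ {ω | holderNorm α (fun t => B t ω) ≤ ε} ∧
        μ {ω | holderNorm α (fun t => B t ω) ≤ ε} ≤
          ENNReal.ofReal (Real.exp (-c₁₄ * ε ^ (-(1 / (H * K - α))))) := by
  obtain ⟨c, hc, h1⟩ := bif_lower hH hK hB hα
  obtain ⟨d, hd, h2⟩ := bif_upper hH hK hB hα
  exact ⟨c, d, hc, hd, fun ε hε => ⟨h1 ε hε.1, h2 ε hε⟩⟩
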